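/- arXiv:1411.4089 — 9 statements merged into one kernel-verified Lean document; each statement's English description precedes it below -/
import Mathlib

section
/- Let d ≥ 1 be a real number. Let f : ℝ × ℝ × ℝ → ℝ be measurable and bounded on [−1,0] × [0,1] × [0,1], and assume that sup_{λ ∈ [−1,0], t ∈ [0,1]} |f(λ,s,t) − f(λ,0,t)| → 0 as s → 0⁺. Let μ : ℝ → ℝ be integrable on [0,1] and bounded on [0,η₀] for some η₀ > 0. Define F(λ,s) = ∫_s^1 t^λ · |s − t|^d · f(λ,s,t) · μ(t) dt for (λ,s) ∈ [−1,0] × [0,1]. Then F is bounded on [−1,0] × [0,1], and sup_{λ ∈ [−1,0]} |F(λ,s) − F(λ,0)| → 0 as s → 0⁺. -/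
open MeasureTheory Filter Set

theorem Real.max_sub_zero_rpow_le_rpow {d s t : ℝ} (hd : 0 ≤ d) (hs : 0 ≤ s) (ht : 0 ≤ t) :
    max (t - s) 0 ^ d ≤ t ^ d :=
  Real.rpow_le_rpow (le_max_right _ _) (max_le (by linarith) ht) hd

theorem Real.rpow_mul_max_sub_zero_rpow_le_one {d l s t : ℝ} (hld : 0 ≤ l + d) (hd : 0 ≤ d)
    (hs : 0 ≤ s) (ht : t ∈ Ioc (0:ℝ) 1) : t ^ l * max (t - s) 0 ^ d ≤ 1 :=
  calc t ^ l * max (t - s) 0 ^ d ≤ t ^ l * t ^ d :=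
        mul_le_mul_of_nonneg_left (Real.max_sub_zero_rpow_le_rpow hd hs ht.1.le)
          (Real.rpow_nonneg ht.1.le _)
    _ = t ^ (l + d) := (Real.rpow_add ht.1 _ _).symm
    _ ≤ 1 := Real.rpow_le_one ht.1.le ht.2 hld

theorem setIntegral_Icc_abs_sub_rpow_eq {d s : ℝ} (hd : d ≠ 0) (hs : 0 ≤ s) (u v : ℝ → ℝ) :
    ∫ t in Icc s 1, u t * |s - t| ^ d * v t =
      ∫ t in Ioc (0:ℝ) 1, u t * max (t - s) 0 ^ d * v t := by
  rw [integral_Icc_eq_integral_Ioc]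
  have hsub : Ioc s 1 ⊆ Ioc (0:ℝ) 1 := Ioc_subset_Ioc_left hs
  rw [setIntegral_congr_fun (g := fun t => u t * max (t - s) 0 ^ d * v t) measurableSet_Ioc]
  · refine (setIntegral_eq_of_subset_of_forall_sdiff_eq_zero measurableSet_Ioc hsub ?_).symm
    rintro t ⟨ht, hts⟩
    have hle : t ≤ s := by
      by_contra! h
      exact hts ⟨h, ht.2⟩
    rw [max_eq_right (by linarith), Real.zero_rpow hd]
    simp
  · intro t ht
    have h : 0 ≤ t - s := by linarith [ht.1]
    simp only [abs_sub_comm s t, abs_of_nonneg h, max_eq_left h]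

theorem aestronglyMeasurable_section_of_measurable_domRestrict {f : ℝ × ℝ × ℝ → ℝ} {A B D : Set ℝ}
    (hD : MeasurableSet D) (hf : Measurable ((A ×ˢ (B ×ˢ D)).domRestrict f)) {l s : ℝ}
    (hl : l ∈ A) (hs : s ∈ B) :
    AEStronglyMeasurable (fun t => f (l, s, t)) (volume.restrict D) := by
  refine (aemeasurable_restrict_of_measurable_subtype hD ?_).aestronglyMeasurable
  have hm : Measurable (fun t : D => (⟨(l, s, t.1), hl, hs, t.2⟩ : ↥(A ×ˢ (B ×ˢ D)))) :=
    Measurable.subtype_mk (by fun_prop)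
  exact hf.comp hm

theorem norm_inv_mul_rpow_sub_rpow_mul_abs_le {d s t : ℝ} (hd : 1 ≤ d) (hs : 0 ≤ s)
    (ht : t ∈ Ioc (0:ℝ) 1) (m : ℝ) :
    ‖t ^ (-1:ℝ) * (t ^ d - max (t - s) 0 ^ d) * |m|‖ ≤ |m| := by
  have hd0 : 0 ≤ d := by linarith
  have h0 := Real.max_sub_zero_rpow_le_rpow hd0 hs ht.1.le
  have h1 := Real.rpow_mul_max_sub_zero_rpow_le_one (l := -1) (d := d) (s := 0) (by linarith)
    hd0 le_rfl ht
  rw [sub_zero, max_eq_left ht.1.le] at h1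
  have hp : 0 ≤ t ^ (-1:ℝ) := Real.rpow_nonneg ht.1.le _
  have hq : 0 ≤ t ^ (-1:ℝ) * max (t - s) 0 ^ d :=
    mul_nonneg hp (Real.rpow_nonneg (le_max_right _ _) _)
  rw [Real.norm_eq_abs, abs_mul, abs_abs, abs_of_nonneg (mul_nonneg hp (sub_nonneg.2 h0))]
  exact mul_le_of_le_one_left (abs_nonneg _) (by linarith)

/-- The integrals `∫ t⁻¹ (t ^ d - (t - s)₊ ^ d) |μ t|` over `(0, 1]` tend to zero as `s → 0⁺`,
by dominated convergence. -/
theorem tendsto_integral_inv_mul_rpow_sub_rpow {d : ℝ} (hd : 1 ≤ d) {μ : ℝ → ℝ}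
    (hμ : IntegrableOn μ (Ioc 0 1)) :
    Tendsto (fun s : ℝ => ∫ t in Ioc (0:ℝ) 1,
      t ^ (-1:ℝ) * (t ^ d - max (t - s) 0 ^ d) * |μ t|) (nhdsWithin 0 (Ioi 0)) (nhds 0) := by
  have hd0 : 0 ≤ d := by linarith
  have key := tendsto_integral_filter_of_dominated_convergence (μ := volume.restrict (Ioc (0:ℝ) 1))
    (l := nhdsWithin (0:ℝ) (Ioi 0)) (f := fun _ => (0:ℝ))
    (F := fun s t => t ^ (-1:ℝ) * (t ^ d - max (t - s) 0 ^ d) * |μ t|) (fun t => |μ t|)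
    ?_ ?_ hμ.abs ?_
  · simpa using key
  · refine Eventually.of_forall fun s => ?_
    refine AEStronglyMeasurable.mul (Measurable.aestronglyMeasurable (by fun_prop))
      hμ.abs.aestronglyMeasurable
  · filter_upwards [self_mem_nhdsWithin] with s hs
    exact (ae_restrict_iff' measurableSet_Ioc).2 (Eventually.of_forall fun t ht =>
      norm_inv_mul_rpow_sub_rpow_mul_abs_le hd (le_of_lt hs) ht (μ t))
  · refine (ae_restrict_iff' measurableSet_Ioc).2 (Eventually.of_forall fun t ht => ?_)
    have hc : Continuous fun s : ℝ => t ^ (-1:ℝ) * (t ^ d - max (t - s) 0 ^ d) * |μ t| := by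
      have : Continuous fun s : ℝ => max (t - s) 0 ^ d :=
        Continuous.rpow_const (by fun_prop) fun _ => Or.inr hd0
      fun_prop
    have h := (hc.tendsto 0).mono_left (nhdsWithin_le_nhds (s := Ioi 0))
    simpa [max_eq_left ht.1.le] using h

/-- Lemma 3.6 of the paper: key technical lemma controlling the inner
integrals of the cosine-λ transform near the first pole. -/
theorem cosine_lambda_technical_lemma
    (d : ℝ) (hd : 1 ≤ d) (f : ℝ × ℝ × ℝ → ℝ)
    (hfm : Measurable ((Icc (-1:ℝ) 0 ×ˢ (Icc (0:ℝ) 1 ×ˢ Icc (0:ℝ) 1)).restrict f))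
    (hfb : ∃ C : ℝ, ∀ l ∈ Icc (-1:ℝ) 0, ∀ s ∈ Icc (0:ℝ) 1, ∀ t ∈ Icc (0:ℝ) 1,
      |f (l, s, t)| ≤ C)
    (hfu : Tendsto
      (fun s : ℝ => ⨆ x : Icc (-1:ℝ) 0 × Icc (0:ℝ) 1,
        |f (x.1.1, s, x.2.1) - f (x.1.1, 0, x.2.1)|)
      (nhdsWithin 0 (Ioi 0)) (nhds 0))
    (μ : ℝ → ℝ) (hμint : IntegrableOn μ (Icc 0 1))
    (hμb : ∃ η₀ > (0:ℝ), ∃ M : ℝ, ∀ t ∈ Icc (0:ℝ) η₀, |μ t| ≤ M)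
    (F : ℝ → ℝ → ℝ)
    (hF : ∀ l ∈ Icc (-1:ℝ) 0, ∀ s ∈ Icc (0:ℝ) 1,
      F l s = ∫ t in Icc s 1, t ^ l * |s - t| ^ d * f (l, s, t) * μ t) :
    (∃ C : ℝ, ∀ l ∈ Icc (-1:ℝ) 0, ∀ s ∈ Icc (0:ℝ) 1, |F l s| ≤ C) ∧
    Tendsto (fun s : ℝ => ⨆ l : Icc (-1:ℝ) 0, |F l.1 s - F l.1 0|)
      (nhdsWithin 0 (Ioi 0)) (nhds 0) := by
  obtain ⟨C, hC⟩ := hfb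
  have hd0 : 0 ≤ d := by linarith
  have h01 : (0:ℝ) ∈ Icc (0:ℝ) 1 := by simp
  have hC0 : 0 ≤ C := (abs_nonneg _).trans (hC 0 (by simp) 0 h01 0 h01)
  have hμ : IntegrableOn μ (Ioc 0 1) := hμint.mono_set Ioc_subset_Icc_self
  set K : ℝ → ℝ → ℝ → ℝ := fun l s t => t ^ l * max (t - s) 0 ^ d * (f (l, s, t) * μ t) with hK
  have hFK : ∀ l ∈ Icc (-1:ℝ) 0, ∀ s ∈ Icc (0:ℝ) 1, F l s = ∫ t in Ioc (0:ℝ) 1, K l s t := by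
    intro l hl s hs
    rw [hF l hl s hs, hK, ← setIntegral_Icc_abs_sub_rpow_eq (by linarith) hs.1]
    simp only [mul_assoc]
  have hKle : ∀ l ∈ Icc (-1:ℝ) 0, ∀ s ∈ Icc (0:ℝ) 1, ∀ t ∈ Ioc (0:ℝ) 1,
      ‖K l s t‖ ≤ C * |μ t| := by
    intro l hl s hs t ht
    have h1 := Real.rpow_mul_max_sub_zero_rpow_le_one (l := l) (d := d) (by linarith [hl.1])
      hd0 hs.1 ht
    have h0 : 0 ≤ t ^ l * max (t - s) 0 ^ d :=
      mul_nonneg (Real.rpow_nonneg ht.1.le _) (Real.rpow_nonneg (le_max_right _ _) _)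
    rw [hK, Real.norm_eq_abs, abs_mul, abs_mul (f _), abs_of_nonneg h0]
    exact (mul_le_of_le_one_left (by positivity) h1).trans
      (mul_le_mul_of_nonneg_right (hC l hl s hs t (Ioc_subset_Icc_self ht)) (abs_nonneg _))
  have hKint : ∀ l ∈ Icc (-1:ℝ) 0, ∀ s ∈ Icc (0:ℝ) 1, IntegrableOn (K l s) (Ioc 0 1) := by
    intro l hl s hs
    refine (hμ.abs.const_mul C).mono' ?_ ((ae_restrict_iff' measurableSet_Ioc).2
      (Eventually.of_forall (hKle l hl s hs)))
    have hfs := (aestronglyMeasurable_section_of_measurable_domRestrict measurableSet_Icc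
      hfm hl hs).mono_set Ioc_subset_Icc_self
    exact (Measurable.aestronglyMeasurable (by fun_prop)).mul (hfs.mul hμ.aestronglyMeasurable)
  refine ⟨⟨∫ t in Ioc (0:ℝ) 1, C * |μ t|, fun l hl s hs => ?_⟩, ?_⟩
  · rw [hFK l hl s hs]
    exact norm_integral_le_of_norm_le (hμ.abs.const_mul C)
      ((ae_restrict_iff' measurableSet_Ioc).2 (Eventually.of_forall (hKle l hl s hs)))
  set δ : ℝ → ℝ := fun s => ⨆ x : Icc (-1:ℝ) 0 × Icc (0:ℝ) 1,
    |f (x.1.1, s, x.2.1) - f (x.1.1, 0, x.2.1)| with hδ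
  have hδle : ∀ l ∈ Icc (-1:ℝ) 0, ∀ s ∈ Icc (0:ℝ) 1, ∀ t ∈ Icc (0:ℝ) 1,
      |f (l, s, t) - f (l, 0, t)| ≤ δ s := by
    intro l hl s hs t ht
    refine le_ciSup (f := fun x : Icc (-1:ℝ) 0 × Icc (0:ℝ) 1 =>
      |f (x.1.1, s, x.2.1) - f (x.1.1, 0, x.2.1)|) ⟨C + C, ?_⟩ (⟨l, hl⟩, ⟨t, ht⟩)
    rintro _ ⟨x, rfl⟩
    exact (abs_sub _ _).trans (add_le_add (hC _ x.1.2 _ hs _ x.2.2) (hC _ x.1.2 _ h01 _ x.2.2))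
  set H : ℝ → ℝ → ℝ := fun s t => t ^ (-1:ℝ) * (t ^ d - max (t - s) 0 ^ d) * |μ t| with hH
  have hlim : Tendsto (fun s => δ s * (∫ t in Ioc (0:ℝ) 1, |μ t|) + C * ∫ t in Ioc (0:ℝ) 1, H s t)
      (nhdsWithin 0 (Ioi 0)) (nhds 0) := by
    simpa using (hfu.mul_const (∫ t in Ioc (0:ℝ) 1, |μ t|)).add
      ((tendsto_integral_inv_mul_rpow_sub_rpow hd hμ).const_mul C)
  refine squeeze_zero' (Eventually.of_forall fun s => Real.iSup_nonneg fun _ => abs_nonneg _)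
    ?_ hlim
  filter_upwards [Ioc_mem_nhdsGT (zero_lt_one' ℝ)] with s hs'
  have hs : s ∈ Icc (0:ℝ) 1 := Ioc_subset_Icc_self hs'
  have hHint : IntegrableOn (H s) (Ioc 0 1) := by
    refine hμ.abs.mono' ((Measurable.aestronglyMeasurable (by fun_prop)).mul
      hμ.abs.aestronglyMeasurable) ?_
    exact (ae_restrict_iff' measurableSet_Ioc).2 (Eventually.of_forall fun t ht =>
      norm_inv_mul_rpow_sub_rpow_mul_abs_le hd hs.1 ht (μ t))
  have : Nonempty (Icc (-1:ℝ) 0) := ⟨⟨0, by simp⟩⟩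
  refine ciSup_le fun ⟨l, hl⟩ => ?_
  simp only
  rw [hFK l hl s hs, hFK l hl 0 h01, ← integral_sub (hKint l hl s hs) (hKint l hl 0 h01),
    ← integral_const_mul, ← integral_const_mul,
    ← integral_add (hμ.abs.const_mul _) (hHint.const_mul _), ← Real.norm_eq_abs]
  refine norm_integral_le_of_norm_le ((hμ.abs.const_mul _).add (hHint.const_mul _))
    ((ae_restrict_iff' measurableSet_Ioc).2 (Eventually.of_forall fun t ht => ?_))
  have h1 := Real.rpow_mul_max_sub_zero_rpow_le_one (l := l) (d := d) (by linarith [hl.1])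
    hd0 hs.1 ht
  have h0 : 0 ≤ t ^ l * max (t - s) 0 ^ d :=
    mul_nonneg (Real.rpow_nonneg ht.1.le _) (Real.rpow_nonneg (le_max_right _ _) _)
  have h2 := sub_nonneg.2 (Real.max_sub_zero_rpow_le_rpow hd0 hs.1 ht.1.le)
  have h3 : t ^ l ≤ t ^ (-1:ℝ) := Real.rpow_le_rpow_of_exponent_ge ht.1 ht.2 hl.1
  have hsplit : K l s t - K l 0 t =
      (t ^ l * max (t - s) 0 ^ d) * (f (l, s, t) - f (l, 0, t)) * μ t
        - t ^ l * (t ^ d - max (t - s) 0 ^ d) * f (l, 0, t) * μ t := by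
    simp only [hK, sub_zero, max_eq_left ht.1.le]
    ring
  have ht' := Ioc_subset_Icc_self ht
  have hl0 : 0 ≤ t ^ l := Real.rpow_nonneg ht.1.le _
  rw [hsplit, Real.norm_eq_abs]
  refine (abs_sub _ _).trans (add_le_add ?_ ?_)
  · rw [abs_mul, abs_mul, abs_of_nonneg h0]
    gcongr
    exact (mul_le_of_le_one_left (abs_nonneg _) h1).trans (hδle l hl s hs t ht')
  · rw [abs_mul, abs_mul, abs_of_nonneg (mul_nonneg hl0 h2), hH]
    simp only
    rw [← mul_assoc, mul_comm C]
    gcongr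
    · exact mul_nonneg (Real.rpow_nonneg ht.1.le _) h2
    · exact hC l hl 0 h01 t ht'
end

section
/- Let d ∈ {1,2,4}, let p, q be integers with q ≥ p ≥ 2, and let g : ℝ^p → ℝ be continuous on the cube [0,1]^p. For λ ∈ [−1,0] and u₁ ∈ [0,1] define the iterated integral F(λ,u₁) = ∫_{u₁}^1 ∫_{u₂}^1 ⋯ ∫_{u_{p−1}}^1 [∏_{i=2}^p u_i^{(d(λ+1)−2)/2}] · g(u₁,…,u_p) · [∏_{i=2}^p (1−u_i)^{(d−2+d(q−p))/2}] · [∏_{2 ≤ i < j ≤ p} (u_j−u_i)^d] · [∏_{j=2}^p (u_j−u₁)^d] du_p ⋯ du₂. Then all these integrals are finite, F is bounded on [−1,0] × [0,1], and sup_{λ ∈ [−1,0]} |F(λ,u₁) − F(λ,0)| → 0 as u₁ → 0⁺. -/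
open MeasureTheory Filter Set

/-- Prepend an entry to a vector of length `p - 1`, producing a vector of length `p`. -/
def consVec {p : ℕ} (a : ℝ) (v : Fin (p - 1) → ℝ) (i : Fin p) : ℝ :=
  if h : (i : ℕ) = 0 then a else v ⟨(i : ℕ) - 1, by have := i.isLt; omega⟩

/-- The region of integration `u₁ ≤ u₂ ≤ ⋯ ≤ u_p ≤ 1` (in the variables `u₂, …, u_p`). -/
def region1 (p : ℕ) (u₁ : ℝ) : Set (Fin (p - 1) → ℝ) :=
  {v | Monotone v ∧ ∀ j, u₁ ≤ v j ∧ v j ≤ 1}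

/-- Integrand of the inner (p-1)-fold integral of the cosine-λ transform in the
coordinates `u_i = cos²(t_i)`, as a function of `(u₂, …, u_p)`. -/
noncomputable def integrand1 (d p q : ℕ) (g : (Fin p → ℝ) → ℝ) (l u₁ : ℝ)
    (v : Fin (p - 1) → ℝ) : ℝ :=
  (∏ j, v j ^ (((d : ℝ) * (l + 1) - 2) / 2)) * g (consVec u₁ v) *
    ((∏ j, (1 - v j) ^ (((d : ℝ) - 2 + (d : ℝ) * ((q : ℝ) - (p : ℝ))) / 2)) *
      ((∏ j : Fin (p - 1), ∏ i : Fin (p - 1), if i < j then (v j - v i) ^ d else 1) *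
        ∏ j, (v j - u₁) ^ d))

lemma measurableSet_region1 (p : ℕ) (u : ℝ) : MeasurableSet (region1 p u) := by
  have h : region1 p u = {v | Monotone v} ∩ Icc (fun _ => u) (fun _ => 1) := by
    ext v
    simp [region1, Pi.le_def, forall_and]
  rw [h]
  refine (IsClosed.inter ?_ isClosed_Icc).measurableSet
  simp only [Monotone, Set.ofPred_forall]
  exact isClosed_iInter fun i => isClosed_iInter fun j => isClosed_iInter fun _ =>
    isClosed_le (continuous_apply i) (continuous_apply j)

lemma continuous_consVec (p : ℕ) :
    Continuous fun x : ℝ × (Fin (p - 1) → ℝ) => (consVec x.1 x.2 : Fin p → ℝ) := by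
  refine continuous_pi fun i => ?_
  by_cases h : (i : ℕ) = 0
  · simpa only [consVec, h, dite_true] using continuous_fst
  · simp only [consVec, h, dite_false]
    fun_prop

lemma consVec_mem_Icc {p : ℕ} {u : ℝ} {v : Fin (p - 1) → ℝ} (hu : u ∈ Icc (0 : ℝ) 1)
    (hv : ∀ j, v j ∈ Icc (0 : ℝ) 1) : (consVec u v : Fin p → ℝ) ∈ Icc (0 : Fin p → ℝ) 1 := by
  constructor <;> intro i <;> by_cases h : (i : ℕ) = 0 <;> simp [consVec, h, hu.1, hu.2]
  · exact (hv _).1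
  · exact (hv _).2

lemma mem_Icc_of_mem_region1 {p : ℕ} {u : ℝ} {v : Fin (p - 1) → ℝ} (hu : 0 ≤ u)
    (hv : v ∈ region1 p u) (j : Fin (p - 1)) : v j ∈ Icc (0 : ℝ) 1 :=
  ⟨hu.trans (hv.2 j).1, (hv.2 j).2⟩

/-- The singular factor of the integrand is compensated by the Vandermonde factor. -/
lemma rpow_mul_sub_pow_mem_Icc {d : ℕ} (hd : d ≠ 0) {a u x : ℝ} (ha : -1 ≤ a) (hu : 0 ≤ u)
    (hux : u ≤ x) (hx : x ≤ 1) : x ^ a * (x - u) ^ d ∈ Icc (0 : ℝ) 1 := by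
  have hx0 : 0 ≤ x := hu.trans hux
  refine ⟨mul_nonneg (Real.rpow_nonneg hx0 _) (pow_nonneg (sub_nonneg.2 hux) _), ?_⟩
  rcases hx0.eq_or_lt with rfl | hpos
  · have : u = 0 := le_antisymm hux hu
    simp [this, hd]
  · calc x ^ a * (x - u) ^ d ≤ x ^ (-1 : ℝ) * x := by
          refine mul_le_mul (Real.rpow_le_rpow_of_exponent_ge hpos hx ha) ?_
            (pow_nonneg (sub_nonneg.2 hux) _) (Real.rpow_nonneg hx0 _)
          exact (pow_le_of_le_one (sub_nonneg.2 hux) (by linarith) hd).trans (by linarith)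
      _ = 1 := by rw [Real.rpow_neg_one, inv_mul_cancel₀ hpos.ne']

lemma vandermonde_abs_le_one {n d : ℕ} {v : Fin n → ℝ} (hv : ∀ j, v j ∈ Icc (0 : ℝ) 1) :
    |∏ j : Fin n, ∏ i : Fin n, if i < j then (v j - v i) ^ d else 1| ≤ 1 := by
  rw [Finset.abs_prod]
  refine Finset.prod_le_one (fun _ _ => abs_nonneg _) fun j _ => ?_
  rw [Finset.abs_prod]
  refine Finset.prod_le_one (fun _ _ => abs_nonneg _) fun i _ => ?_
  split_ifs
  · rw [abs_pow]
    refine pow_le_one₀ (abs_nonneg _) (abs_le.2 ⟨?_, ?_⟩) <;>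
      linarith [(hv i).1, (hv i).2, (hv j).1, (hv j).2]
  · simp

lemma abs_integrand1_le {d p q : ℕ} (hd : d ≠ 0) {g : (Fin p → ℝ) → ℝ} {M l u : ℝ}
    (hM : ∀ x ∈ Icc (0 : Fin p → ℝ) 1, |g x| ≤ M) (hl : -1 ≤ l) (hu : u ∈ Icc (0 : ℝ) 1)
    {v : Fin (p - 1) → ℝ} (hv : v ∈ region1 p u) :
    |integrand1 d p q g l u v| ≤
      M * ∏ j, (1 - v j) ^ (((d : ℝ) - 2 + (d : ℝ) * ((q : ℝ) - (p : ℝ))) / 2) := by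
  have hI := mem_Icc_of_mem_region1 hu.1 hv
  have ha : -1 ≤ ((d : ℝ) * (l + 1) - 2) / 2 := by
    have : 0 ≤ (d : ℝ) * (l + 1) := mul_nonneg (Nat.cast_nonneg d) (by linarith)
    linarith
  have hg := hM _ (consVec_mem_Icc hu hI)
  have hV := vandermonde_abs_le_one (d := d) hI
  have hS := fun j => rpow_mul_sub_pow_mem_Icc hd ha hu.1 (hv.2 j).1 (hv.2 j).2
  have hB : 0 ≤ ∏ j, (1 - v j) ^ (((d : ℝ) - 2 + (d : ℝ) * ((q : ℝ) - (p : ℝ))) / 2) :=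
    Finset.prod_nonneg fun j _ => Real.rpow_nonneg (sub_nonneg.2 (hI j).2) _
  have hP : |∏ j, v j ^ (((d : ℝ) * (l + 1) - 2) / 2) * (v j - u) ^ d| ≤ 1 := by
    rw [abs_of_nonneg (Finset.prod_nonneg fun j _ => (hS j).1)]
    exact Finset.prod_le_one (fun j _ => (hS j).1) fun j _ => (hS j).2
  have key : ∀ A G B V D : ℝ, |A * D| ≤ 1 → |G| ≤ M → 0 ≤ B → |V| ≤ 1 →
      |A * G * (B * (V * D))| ≤ M * B := by
    intro A G B V D hAD hG hB hV
    have : A * G * (B * (V * D)) = G * B * (V * (A * D)) := by ring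
    rw [this, abs_mul, abs_mul, abs_mul, abs_of_nonneg hB]
    have h1 : |V| * |A * D| ≤ 1 := mul_le_one₀ hV (abs_nonneg _) hAD
    exact (mul_le_of_le_one_right (mul_nonneg (abs_nonneg _) hB) h1).trans
      (mul_le_mul_of_nonneg_right hG hB)
  rw [Finset.prod_mul_distrib] at hP
  exact key _ _ _ _ _ hP hg hB hV

lemma integrable_prod_indicator_one_sub_rpow (n : ℕ) {b : ℝ} (hb : -1 < b) :
    Integrable fun v : Fin n → ℝ =>
      ∏ j, (Icc (0 : ℝ) 1).indicator (fun x => (1 - x) ^ b) (v j) := by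
  refine Integrable.fintype_prod fun _ => ?_
  rw [integrable_indicator_iff measurableSet_Icc, integrableOn_Icc_iff_integrableOn_Ioc,
    ← intervalIntegrable_iff_integrableOn_Ioc_of_le zero_le_one]
  simpa using
    ((intervalIntegral.intervalIntegrable_rpow' (a := 0) (b := 1) hb).comp_sub_left 1).symm

lemma aestronglyMeasurable_integrand1 {d p q : ℕ} {g : (Fin p → ℝ) → ℝ}
    (hg : ContinuousOn g (Icc (0 : Fin p → ℝ) 1)) (l : ℝ) {u : ℝ} (hu : u ∈ Icc (0 : ℝ) 1) :
    AEStronglyMeasurable (integrand1 d p q g l u) (volume.restrict (region1 p u)) := by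
  have hc : ContinuousOn (fun v : Fin (p - 1) → ℝ => g (consVec u v)) (region1 p u) :=
    hg.comp ((continuous_consVec p).comp (by fun_prop : Continuous fun v => (u, v))).continuousOn
      fun v hv => consVec_mem_Icc hu (mem_Icc_of_mem_region1 hu.1 hv)
  refine AEStronglyMeasurable.mul (AEStronglyMeasurable.mul ?_
    (hc.aestronglyMeasurable (measurableSet_region1 p u))) ?_
  · exact Measurable.aestronglyMeasurable (by fun_prop)
  · refine Measurable.aestronglyMeasurable (Measurable.mul (by fun_prop) (Measurable.mul ?_
      (by fun_prop)))
    refine Finset.measurable_prod _ fun j _ => Finset.measurable_prod _ fun i _ => ?_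
    split_ifs <;> fun_prop

lemma abs_indicator_integrand1_le {d p q : ℕ} (hd : d ≠ 0) {g : (Fin p → ℝ) → ℝ} {M l u : ℝ}
    (hM0 : 0 ≤ M) (hM : ∀ x ∈ Icc (0 : Fin p → ℝ) 1, |g x| ≤ M) (hl : -1 ≤ l)
    (hu : u ∈ Icc (0 : ℝ) 1) (v : Fin (p - 1) → ℝ) :
    |(region1 p u).indicator (integrand1 d p q g l u) v| ≤
      M * ∏ j, (Icc (0 : ℝ) 1).indicator
        (fun x => (1 - x) ^ (((d : ℝ) - 2 + (d : ℝ) * ((q : ℝ) - (p : ℝ))) / 2)) (v j) := by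
  by_cases hv : v ∈ region1 p u
  · have hI := mem_Icc_of_mem_region1 hu.1 hv
    rw [indicator_of_mem hv]
    simpa only [indicator_of_mem (hI _)] using abs_integrand1_le hd hM hl hu hv
  · rw [indicator_of_notMem hv, abs_zero]
    refine mul_nonneg hM0 (Finset.prod_nonneg fun j _ => indicator_nonneg (fun x hx => ?_) _)
    exact Real.rpow_nonneg (sub_nonneg.2 hx.2) _

lemma indicator_integrand1_eq_zero {d p q : ℕ} (hd : d ≠ 0) (g : (Fin p → ℝ) → ℝ) (l : ℝ) {u : ℝ}
    (hu : 0 ≤ u) {v : Fin (p - 1) → ℝ} {j : Fin (p - 1)} (hj : v j ≤ 0) :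
    (region1 p u).indicator (integrand1 d p q g l u) v = 0 := by
  refine indicator_apply_eq_zero.2 fun hv => ?_
  have h : v j - u = 0 := by linarith [(hv.2 j).1]
  have : ∏ j, (v j - u) ^ d = 0 := Finset.prod_eq_zero (Finset.mem_univ j) (by rw [h, zero_pow hd])
  rw [integrand1, this, mul_zero, mul_zero, mul_zero]

/-- The increment in `u` of the integrand is largest at the endpoint `l = -1`. -/
lemma abs_indicator_integrand1_sub_le {d p q : ℕ} (hd : d ≠ 0) (g : (Fin p → ℝ) → ℝ) {l u : ℝ}
    (hl : -1 ≤ l) (hu : 0 ≤ u) (v : Fin (p - 1) → ℝ) :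
    |(region1 p u).indicator (integrand1 d p q g l u) v -
        (region1 p 0).indicator (integrand1 d p q g l 0) v| ≤
      |(region1 p u).indicator (integrand1 d p q g (-1) u) v -
        (region1 p 0).indicator (integrand1 d p q g (-1) 0) v| := by
  by_cases hneg : ∃ j, v j ≤ 0
  · obtain ⟨j, hj⟩ := hneg
    simp only [indicator_integrand1_eq_zero hd g _ hu hj,
      indicator_integrand1_eq_zero hd g _ le_rfl hj, le_refl]
  push Not at hneg
  by_cases h0 : v ∈ region1 p 0
  · obtain ⟨H, hH⟩ : ∃ H : ℝ → ℝ, ∀ m w, (region1 p w).indicator (integrand1 d p q g m w) v =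
        (∏ j, v j ^ (((d : ℝ) * (m + 1) - 2) / 2)) * H w := by
      refine ⟨fun w => (region1 p w).indicator (fun v => g (consVec w v) *
        ((∏ j, (1 - v j) ^ (((d : ℝ) - 2 + (d : ℝ) * ((q : ℝ) - (p : ℝ))) / 2)) *
          ((∏ j : Fin (p - 1), ∏ i : Fin (p - 1), if i < j then (v j - v i) ^ d else 1) *
            ∏ j, (v j - w) ^ d))) v, fun m w => ?_⟩
      by_cases hw : v ∈ region1 p w
      · simp only [indicator_of_mem hw, integrand1, mul_assoc]
      · simp only [indicator_of_notMem hw, mul_zero]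
    simp only [hH, ← mul_sub, abs_mul]
    refine mul_le_mul_of_nonneg_right ?_ (abs_nonneg _)
    have hnn : ∀ m : ℝ, 0 ≤ ∏ j, v j ^ (((d : ℝ) * (m + 1) - 2) / 2) := fun m =>
      Finset.prod_nonneg fun j _ => Real.rpow_nonneg (hneg j).le _
    rw [abs_of_nonneg (hnn _), abs_of_nonneg (hnn _)]
    refine Finset.prod_le_prod (fun j _ => Real.rpow_nonneg (hneg j).le _) fun j _ => ?_
    refine Real.rpow_le_rpow_of_exponent_ge (hneg j) (h0.2 j).2 ?_
    have : (d : ℝ) * (-1 + 1) ≤ d * (l + 1) :=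
      mul_le_mul_of_nonneg_left (by linarith) (Nat.cast_nonneg d)
    linarith
  · have hu' : v ∉ region1 p u := fun h => h0 ⟨h.1, fun j => ⟨hu.trans (h.2 j).1, (h.2 j).2⟩⟩
    simp only [indicator_of_notMem h0, indicator_of_notMem hu', le_refl]

lemma tendsto_indicator_integrand1 {d p q : ℕ} (hd : d ≠ 0) {g : (Fin p → ℝ) → ℝ}
    (hg : ContinuousOn g (Icc (0 : Fin p → ℝ) 1)) (l : ℝ) (v : Fin (p - 1) → ℝ) :
    Tendsto (fun u => (region1 p u).indicator (integrand1 d p q g l u) v) (nhdsWithin 0 (Ioi 0))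
      (nhds ((region1 p 0).indicator (integrand1 d p q g l 0) v)) := by
  by_cases hneg : ∃ j, v j ≤ 0
  · obtain ⟨j, hj⟩ := hneg
    rw [indicator_integrand1_eq_zero hd g l le_rfl hj]
    refine tendsto_const_nhds.congr' ?_
    filter_upwards [self_mem_nhdsWithin] with u hu
    exact (indicator_integrand1_eq_zero hd g l (le_of_lt hu) hj).symm
  push Not at hneg
  by_cases h0 : v ∈ region1 p 0
  · have hev : ∀ᶠ u in nhdsWithin (0 : ℝ) (Ioi 0), v ∈ region1 p u := by
      have : ∀ᶠ u in nhdsWithin (0 : ℝ) (Ioi 0), ∀ j, u < v j :=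
        eventually_all.2 fun j => nhdsWithin_le_nhds (eventually_lt_nhds (hneg j))
      filter_upwards [this] with u hu
      exact ⟨h0.1, fun j => ⟨(hu j).le, (h0.2 j).2⟩⟩
    have hI := mem_Icc_of_mem_region1 le_rfl h0
    have hgt : Tendsto (fun u => g (consVec u v)) (nhdsWithin 0 (Ioi 0))
        (nhds (g (consVec 0 v))) := by
      have hmem : (consVec 0 v : Fin p → ℝ) ∈ Icc (0 : Fin p → ℝ) 1 :=
        consVec_mem_Icc ⟨le_rfl, zero_le_one⟩ hI
      refine (hg _ hmem).tendsto.comp (tendsto_nhdsWithin_iff.2 ⟨?_, ?_⟩)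
      · exact (((continuous_consVec p).comp
          (by fun_prop : Continuous fun u : ℝ => (u, v))).tendsto 0).mono_left nhdsWithin_le_nhds
      · filter_upwards [Ioo_mem_nhdsGT (zero_lt_one' ℝ)] with u hu
        exact consVec_mem_Icc ⟨hu.1.le, hu.2.le⟩ hI
    have hpt : Tendsto (fun u : ℝ => ∏ j, (v j - u) ^ d) (nhdsWithin 0 (Ioi 0))
        (nhds (∏ j, (v j - 0) ^ d)) :=
      ((by fun_prop : Continuous fun u : ℝ => ∏ j, (v j - u) ^ d).tendsto 0).mono_left
        nhdsWithin_le_nhds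
    rw [indicator_of_mem h0]
    refine Tendsto.congr' (f₁ := fun u => integrand1 d p q g l u v) ?_ ?_
    · filter_upwards [hev] with u hu
      rw [indicator_of_mem hu]
    · exact (hgt.const_mul _).mul ((hpt.const_mul _).const_mul _)
  · rw [indicator_of_notMem h0]
    refine tendsto_const_nhds.congr' ?_
    filter_upwards [self_mem_nhdsWithin] with u hu
    refine (indicator_of_notMem (fun h => h0 ⟨h.1, fun j => ⟨?_, (h.2 j).2⟩⟩) _).symm
    exact (le_of_lt hu).trans (h.2 j).1

/-- Lemma 3.8 of the paper: the inner (p-1)-fold integral of the cosine-λ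
transform is finite, bounded, and converges uniformly in λ as u₁ → 0⁺. -/
theorem inner_integral_uniform_convergence
    (d p q : ℕ) (hd : d = 1 ∨ d = 2 ∨ d = 4) (hp : 2 ≤ p) (hpq : p ≤ q)
    (g : (Fin p → ℝ) → ℝ) (hg : ContinuousOn g (Icc (0 : Fin p → ℝ) 1))
    (F : ℝ → ℝ → ℝ)
    (hF : ∀ l u₁ : ℝ, F l u₁ = ∫ v in region1 p u₁, integrand1 d p q g l u₁ v) :
    (∀ l ∈ Icc (-1:ℝ) 0, ∀ u₁ ∈ Icc (0:ℝ) 1,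
      IntegrableOn (integrand1 d p q g l u₁) (region1 p u₁)) ∧
    (∃ C : ℝ, ∀ l ∈ Icc (-1:ℝ) 0, ∀ u₁ ∈ Icc (0:ℝ) 1, |F l u₁| ≤ C) ∧
    Tendsto (fun u₁ : ℝ => ⨆ l : Icc (-1:ℝ) 0, |F l.1 u₁ - F l.1 0|)
      (nhdsWithin 0 (Ioi 0)) (nhds 0) := by
  have hd0 : d ≠ 0 := by omega
  obtain ⟨M, hM⟩ := isCompact_Icc.exists_bound_of_continuousOn hg
  simp only [Real.norm_eq_abs] at hM
  have hM0 : 0 ≤ M := (abs_nonneg _).trans (hM 0 ⟨le_rfl, zero_le_one⟩)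
  set b : ℝ := ((d : ℝ) - 2 + (d : ℝ) * ((q : ℝ) - (p : ℝ))) / 2 with hb
  have hb1 : -1 < b := by
    have h1 : (1 : ℝ) ≤ d := by exact_mod_cast Nat.one_le_iff_ne_zero.2 hd0
    have h2 : (p : ℝ) ≤ q := by exact_mod_cast hpq
    have h3 : 0 ≤ (d : ℝ) * ((q : ℝ) - p) := mul_nonneg (by linarith) (by linarith)
    rw [hb]
    linarith
  set D : (Fin (p - 1) → ℝ) → ℝ := fun v =>
    M * ∏ j, (Icc (0 : ℝ) 1).indicator (fun x => (1 - x) ^ b) (v j) with hD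
  have hDint : Integrable D := (integrable_prod_indicator_one_sub_rpow (p - 1) hb1).const_mul M
  set G : ℝ → ℝ → (Fin (p - 1) → ℝ) → ℝ :=
    fun l u => (region1 p u).indicator (integrand1 d p q g l u) with hG
  have hbound : ∀ l ∈ Icc (-1 : ℝ) 0, ∀ u ∈ Icc (0 : ℝ) 1, ∀ v, |G l u v| ≤ D v :=
    fun l hl u hu v => abs_indicator_integrand1_le hd0 hM0 hM hl.1 hu v
  have hGint : ∀ l ∈ Icc (-1 : ℝ) 0, ∀ u ∈ Icc (0 : ℝ) 1, Integrable (G l u) := fun l hl u hu =>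
    hDint.mono' ((aestronglyMeasurable_indicator_iff (measurableSet_region1 p u)).2
      (aestronglyMeasurable_integrand1 hg l hu)) (ae_of_all _ (hbound l hl u hu))
  have hFG : ∀ l u, F l u = ∫ v, G l u v := fun l u => by
    rw [hF, hG, integral_indicator (measurableSet_region1 p u)]
  have hz : (0 : ℝ) ∈ Icc (0 : ℝ) 1 := ⟨le_rfl, zero_le_one⟩
  have hm : (-1 : ℝ) ∈ Icc (-1 : ℝ) 0 := ⟨le_rfl, by norm_num⟩
  have hev : ∀ᶠ u in nhdsWithin (0 : ℝ) (Ioi 0), u ∈ Icc (0 : ℝ) 1 := by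
    filter_upwards [Ioo_mem_nhdsGT (zero_lt_one' ℝ)] with u hu
    exact ⟨hu.1.le, hu.2.le⟩
  refine ⟨fun l hl u hu => (integrable_indicator_iff (measurableSet_region1 p u)).1
    (hGint l hl u hu), ⟨∫ v, D v, fun l hl u hu => ?_⟩, ?_⟩
  · rw [hFG]
    exact norm_integral_le_of_norm_le hDint (f := G l u) (ae_of_all _ (hbound l hl u hu))
  · have hlim : Tendsto (fun u => ∫ v, |G (-1) u v - G (-1) 0 v|) (nhdsWithin 0 (Ioi 0))
        (nhds (∫ _ : Fin (p - 1) → ℝ, (0 : ℝ))) := by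
      refine tendsto_integral_filter_of_dominated_convergence (fun v => D v + D v) ?_ ?_
        (hDint.add hDint) ?_
      · filter_upwards [hev] with u hu
        exact ((hGint _ hm u hu).sub (hGint _ hm 0 hz)).abs.aestronglyMeasurable
      · filter_upwards [hev] with u hu
        refine ae_of_all _ fun v => ?_
        rw [Real.norm_eq_abs, abs_abs]
        exact (abs_sub _ _).trans (add_le_add (hbound _ hm u hu v) (hbound _ hm 0 hz v))
      · refine ae_of_all _ fun v => ?_
        have h := ((tendsto_indicator_integrand1 (q := q) hd0 hg (-1) v).sub_const
          (G (-1) 0 v)).abs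
        rwa [hG, sub_self, abs_zero] at h
    rw [integral_zero] at hlim
    refine squeeze_zero' (Eventually.of_forall fun u => Real.iSup_nonneg fun _ => abs_nonneg _)
      ?_ hlim
    filter_upwards [hev] with u hu
    refine Real.iSup_le (fun l => ?_) (integral_nonneg fun _ => abs_nonneg _)
    rw [hFG, hFG, ← integral_sub (hGint _ l.2 u hu) (hGint _ l.2 0 hz)]
    exact norm_integral_le_of_norm_le (f := fun v => G l u v - G l 0 v)
      ((hGint _ hm u hu).sub (hGint _ hm 0 hz)).abs
      (ae_of_all _ fun v => abs_indicator_integrand1_sub_le hd0 g l.2.1 hu.1 v)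
end

section
/- Let F : [−1,0] × [0,1] → ℝ be bounded, with u ↦ F(λ,u) measurable for each λ. Assume sup_{λ ∈ [−1,0]} |F(λ,u) − F(λ,0)| → 0 as u → 0⁺, and that λ ↦ F(λ,0) is continuous at λ = −1. Then lim_{λ → −1⁺} (λ+1) · ∫_0^1 u^λ F(λ,u) du = F(−1,0). -/
open MeasureTheory Filter Set

lemma integrableOn_Ioc_zero_one_rpow {l : ℝ} (hl : -1 < l) :
    IntegrableOn (fun u : ℝ => u ^ l) (Ioc 0 1) :=
  (intervalIntegrable_iff_integrableOn_Ioc_of_le zero_le_one).1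
    (intervalIntegral.intervalIntegrable_rpow' hl)

lemma integral_Ioc_zero_one_rpow {l : ℝ} (hl : -1 < l) :
    ∫ u in Ioc (0:ℝ) 1, u ^ l = (l + 1)⁻¹ := by
  rw [← intervalIntegral.integral_of_le zero_le_one, integral_rpow (Or.inl hl)]
  simp [Real.zero_rpow (by linarith : l + 1 ≠ 0)]

/-- The probability density `(l + 1) * u ^ l` on `(0, 1]` averages a function lying within
`ε + K * u` of `c` to a value within `ε + K * (l + 1)` of `c`. -/
lemma abs_mul_integral_rpow_mul_sub_le {l ε K c : ℝ} {f : ℝ → ℝ} (hl : -1 < l) (hK : 0 ≤ K)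
    (hf : AEStronglyMeasurable f (volume.restrict (Ioc 0 1)))
    (hb : ∀ u ∈ Ioc (0:ℝ) 1, |f u - c| ≤ ε + K * u) :
    |(l + 1) * (∫ u in Ioc (0:ℝ) 1, u ^ l * f u) - c| ≤ ε + K * (l + 1) := by
  have hl1 : 0 < l + 1 := by linarith
  have hi := integrableOn_Ioc_zero_one_rpow hl
  have hi' := integrableOn_Ioc_zero_one_rpow (l := l + 1) (by linarith)
  have hg : IntegrableOn (fun u : ℝ => ε * u ^ l + K * u ^ (l + 1)) (Ioc 0 1) :=
    (hi.const_mul ε).add (hi'.const_mul K)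
  have hle : ∀ᵐ u ∂volume.restrict (Ioc (0:ℝ) 1),
      ‖u ^ l * (f u - c)‖ ≤ ε * u ^ l + K * u ^ (l + 1) := by
    filter_upwards [ae_restrict_mem measurableSet_Ioc] with u hu
    have hp := Real.rpow_nonneg hu.1.le l
    rw [norm_mul, Real.norm_of_nonneg hp, Real.norm_eq_abs, Real.rpow_add_one hu.1.ne']
    calc u ^ l * |f u - c| ≤ u ^ l * (ε + K * u) := by gcongr; exact hb u hu
      _ = _ := by ring
  have hd : IntegrableOn (fun u : ℝ => u ^ l * (f u - c)) (Ioc 0 1) :=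
    hg.mono' (hi.aestronglyMeasurable.mul (hf.sub aestronglyMeasurable_const)) hle
  have hsplit : ∫ u in Ioc (0:ℝ) 1, u ^ l * f u
      = (∫ u in Ioc (0:ℝ) 1, u ^ l * (f u - c)) + (l + 1)⁻¹ * c := by
    rw [← integral_Ioc_zero_one_rpow hl, ← integral_mul_const,
      ← integral_add hd (hi.mul_const c)]
    congr with u
    ring
  have hnorm := norm_integral_le_of_norm_le hg hle
  rw [integral_add (hi.const_mul ε) (hi'.const_mul K), integral_const_mul, integral_const_mul,
    integral_Ioc_zero_one_rpow hl, integral_Ioc_zero_one_rpow (by linarith),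
    Real.norm_eq_abs] at hnorm
  rw [hsplit, mul_add, mul_inv_cancel_left₀ hl1.ne', add_sub_cancel_right, abs_mul,
    abs_of_pos hl1]
  have hinv : (l + 1 + 1)⁻¹ ≤ 1 := inv_le_one_of_one_le₀ (by linarith)
  calc (l + 1) * |∫ u in Ioc (0:ℝ) 1, u ^ l * (f u - c)|
      ≤ (l + 1) * (ε * (l + 1)⁻¹ + K * (l + 1 + 1)⁻¹) := by gcongr
    _ ≤ (l + 1) * (ε * (l + 1)⁻¹ + K * 1) := by gcongr
    _ = ε + K * (l + 1) := by field_simp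

/-- key limit computation in Theorem 3.9 of the paper evaluating the
analytic continuation of the normalized cosine-λ transform at the first pole λ = -1. -/
theorem limit_at_first_pole
    (F : ℝ → ℝ → ℝ)
    (hFb : ∃ C : ℝ, ∀ l ∈ Icc (-1:ℝ) 0, ∀ u ∈ Icc (0:ℝ) 1, |F l u| ≤ C)
    (hFm : ∀ l ∈ Icc (-1:ℝ) 0, Measurable ((Icc (0:ℝ) 1).restrict (F l)))
    (hFu : Tendsto (fun u : ℝ => ⨆ l : Icc (-1:ℝ) 0, |F l.1 u - F l.1 0|)
      (nhdsWithin 0 (Ioi 0)) (nhds 0))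
    (hFc : ContinuousWithinAt (fun l => F l 0) (Icc (-1) 0) (-1)) :
    Tendsto (fun l : ℝ => (l + 1) * ∫ u in Icc (0:ℝ) 1, u ^ l * F l u)
      (nhdsWithin (-1) (Ioi (-1))) (nhds (F (-1) 0)) := by
  obtain ⟨C, hC⟩ := hFb
  have hC0 : 0 ≤ C := (abs_nonneg _).trans (hC 0 (by simp) 0 (by simp))
  have hdiff : ∀ l ∈ Icc (-1:ℝ) 0, ∀ u ∈ Icc (0:ℝ) 1, |F l u - F l 0| ≤ 2 * C := by
    intro l hl u hu
    have h := abs_sub (F l u) (F l 0)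
    linarith [hC l hl u hu, hC l hl 0 (by simp)]
  have hmem : ∀ᶠ l in nhdsWithin (-1:ℝ) (Ioi (-1)), l ∈ Ioo (-1:ℝ) 0 :=
    Ioo_mem_nhdsGT (by norm_num)
  have hF0 : Tendsto (fun l => F l 0) (nhdsWithin (-1) (Ioi (-1))) (nhds (F (-1) 0)) :=
    hFc.tendsto.mono_left <| nhdsWithin_le_of_mem <|
      mem_of_superset (Ioo_mem_nhdsGT (by norm_num)) Ioo_subset_Icc_self
  refine hF0.congr_dist (Metric.tendsto_nhds.2 fun ε hε => ?_)
  obtain ⟨δ, hδ, hsup⟩ := mem_nhdsGT_iff_exists_Ioo_subset.1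
    (hFu.eventually (gt_mem_nhds (half_pos hε)))
  have hδ : 0 < δ := hδ
  have hlin : ∀ l ∈ Icc (-1:ℝ) 0, ∀ u ∈ Ioc (0:ℝ) 1,
      |F l u - F l 0| ≤ ε / 2 + 2 * C / δ * u := by
    intro l hl u hu
    rcases lt_or_ge u δ with h | h
    · have hbdd : BddAbove (range fun l : Icc (-1:ℝ) 0 => |F l.1 u - F l.1 0|) :=
        ⟨2 * C, by rintro _ ⟨m, rfl⟩; exact hdiff m m.2 u (Ioc_subset_Icc_self hu)⟩
      have h1 := le_ciSup hbdd ⟨l, hl⟩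
      have h2 : (⨆ l : Icc (-1:ℝ) 0, |F l.1 u - F l.1 0|) < ε / 2 := hsup ⟨hu.1, h⟩
      have h3 : 0 ≤ 2 * C / δ * u := mul_nonneg (by positivity) hu.1.le
      exact h1.trans (by linarith)
    · have h1 := hdiff l hl u (Ioc_subset_Icc_self hu)
      have h2 : 2 * C ≤ 2 * C / δ * u := by
        rw [div_mul_eq_mul_div, le_div_iff₀ hδ]
        gcongr
      linarith
  have hsmall : ∀ᶠ l in nhdsWithin (-1:ℝ) (Ioi (-1)), 2 * C / δ * (l + 1) < ε / 2 := by
    have hcont : Continuous fun l : ℝ => 2 * C / δ * (l + 1) := by fun_prop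
    exact nhdsWithin_le_nhds
      ((hcont.tendsto (-1)).eventually (gt_mem_nhds (by simpa using hε)))
  filter_upwards [hmem, hsmall] with l hl hls
  have hl' := Ioo_subset_Icc_self hl
  have hmeas : AEStronglyMeasurable (F l) (volume.restrict (Ioc 0 1)) :=
    ((aemeasurable_restrict_of_measurable_subtype measurableSet_Icc (hFm l hl')).mono_set
      Ioc_subset_Icc_self).aestronglyMeasurable
  have key := abs_mul_integral_rpow_mul_sub_le hl.1 (by positivity) hmeas (hlin l hl')
  rw [integral_Icc_eq_integral_Ioc, dist_zero_right, Real.norm_of_nonneg dist_nonneg, dist_comm,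
    Real.dist_eq]
  linarith
end

section
/- Let F : [−1,0] × [0,1] → ℝ be bounded, with u ↦ F(λ,u) measurable for each λ. Let μ : [0,1] → ℝ be Lebesgue integrable on [0,1], continuous at 0, with μ(0) = 1. Then lim_{λ → −1⁺} (λ+1) · ∫_0^1 u^λ (μ(u) − 1) F(λ,u) du = 0. Consequently, lim_{λ → −1⁺} (λ+1) ∫_0^1 u^λ μ(u) F(λ,u) du exists if and only if lim_{λ → −1⁺} (λ+1) ∫_0^1 u^λ F(λ,u) du exists, and in that case the two limits are equal. -/
open MeasureTheory Filter Set

theorem integrableOn_rpow_Icc_zero_one {l : ℝ} (hl : -1 < l) :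
    IntegrableOn (fun u : ℝ => u ^ l) (Icc 0 1) := by
  rw [integrableOn_Icc_iff_integrableOn_Ioc,
    ← intervalIntegrable_iff_integrableOn_Ioc_of_le zero_le_one]
  exact intervalIntegral.intervalIntegrable_rpow' hl

theorem integral_rpow_Icc_zero_one {l : ℝ} (hl : -1 < l) :
    ∫ u in Icc (0:ℝ) 1, u ^ l = 1 / (l + 1) := by
  rw [integral_Icc_eq_integral_Ioc, ← intervalIntegral.integral_of_le zero_le_one,
    integral_rpow (Or.inl hl), Real.one_rpow, Real.zero_rpow (by linarith), sub_zero]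

/-- A weight at most `ε` on `[0, δ]` splits against the singular kernel `u ^ l` into a small
singular part and an integrable part with a bounded coefficient. -/
theorem abs_rpow_mul_mul_le {l u w f δ ε C : ℝ} (hl : l ∈ Ioo (-1:ℝ) 0) (hu : u ∈ Icc (0:ℝ) 1)
    (hδ : 0 < δ) (hδ1 : δ ≤ 1) (hε : 0 ≤ ε) (hw : u ≤ δ → |w| ≤ ε) (hf : |f| ≤ C) :
    |u ^ l * w * f| ≤ C * (ε * u ^ l + δ⁻¹ * |w|) := by
  have hul : 0 ≤ u ^ l := Real.rpow_nonneg hu.1 l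
  have hw0 : 0 ≤ δ⁻¹ * |w| := by positivity
  have key : u ^ l * |w| ≤ ε * u ^ l + δ⁻¹ * |w| := by
    rcases le_or_gt u δ with h | h
    · nlinarith [mul_le_mul_of_nonneg_left (hw h) hul]
    · have h1 : u ^ l ≤ δ ^ l := Real.rpow_le_rpow_of_nonpos hδ h.le hl.2.le
      have h2 : δ ^ l ≤ δ⁻¹ := by
        rw [← Real.rpow_neg_one]
        exact Real.rpow_le_rpow_of_exponent_ge hδ hδ1 hl.1.le
      have := mul_le_mul_of_nonneg_right (h1.trans h2) (abs_nonneg w)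
      have : 0 ≤ ε * u ^ l := by positivity
      linarith
  rw [abs_mul, abs_mul, abs_of_nonneg hul, mul_comm C]
  exact mul_le_mul key hf (abs_nonneg f) (by positivity)

theorem integrableOn_and_abs_integral_rpow_mul_mul_le {w f : ℝ → ℝ} {l δ ε C : ℝ}
    (hl : l ∈ Ioo (-1:ℝ) 0) (hδ : 0 < δ) (hδ1 : δ ≤ 1) (hε : 0 ≤ ε)
    (hwi : IntegrableOn w (Icc 0 1)) (hw : ∀ u ∈ Icc (0:ℝ) 1, u ≤ δ → |w u| ≤ ε)
    (hfm : AEStronglyMeasurable f (volume.restrict (Icc 0 1)))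
    (hf : ∀ u ∈ Icc (0:ℝ) 1, |f u| ≤ C) :
    IntegrableOn (fun u => u ^ l * w u * f u) (Icc 0 1) ∧
      |∫ u in Icc (0:ℝ) 1, u ^ l * w u * f u| ≤
        C * (ε * (1 / (l + 1)) + δ⁻¹ * ∫ u in Icc (0:ℝ) 1, |w u|) := by
  have hr := integrableOn_rpow_Icc_zero_one hl.1
  have hdom : IntegrableOn (fun u => C * (ε * u ^ l + δ⁻¹ * |w u|)) (Icc 0 1) :=
    ((hr.const_mul ε).add (hwi.abs.const_mul δ⁻¹)).const_mul C
  have hbd : ∀ᵐ u ∂volume.restrict (Icc (0:ℝ) 1),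
      ‖u ^ l * w u * f u‖ ≤ C * (ε * u ^ l + δ⁻¹ * |w u|) :=
    (ae_restrict_mem measurableSet_Icc).mono fun u hu =>
      abs_rpow_mul_mul_le hl hu hδ hδ1 hε (hw u hu) (hf u hu)
  refine ⟨hdom.mono' ((hr.aestronglyMeasurable.mul hwi.aestronglyMeasurable).mul hfm) hbd, ?_⟩
  refine (norm_integral_le_of_norm_le hdom hbd).trans_eq ?_
  rw [integral_const_mul, integral_add (hr.const_mul ε) (hwi.abs.const_mul δ⁻¹),
    integral_const_mul, integral_const_mul, integral_rpow_Icc_zero_one hl.1]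

/-- Lemma 3.11 of the paper: the integrable weight μ with μ(0) = 1 may be
ignored when computing the limit of the normalized transform at λ = -1. -/
theorem weight_factor_ignorable_at_first_pole
    (F : ℝ → ℝ → ℝ)
    (hFb : ∃ C : ℝ, ∀ l ∈ Icc (-1:ℝ) 0, ∀ u ∈ Icc (0:ℝ) 1, |F l u| ≤ C)
    (hFm : ∀ l ∈ Icc (-1:ℝ) 0, Measurable ((Icc (0:ℝ) 1).restrict (F l)))
    (μ : ℝ → ℝ) (hμint : IntegrableOn μ (Icc 0 1))
    (hμc : ContinuousWithinAt μ (Icc 0 1) 0) (hμ0 : μ 0 = 1) :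
    Tendsto (fun l : ℝ => (l + 1) * ∫ u in Icc (0:ℝ) 1, u ^ l * (μ u - 1) * F l u)
      (nhdsWithin (-1) (Ioi (-1))) (nhds 0) ∧
    ∀ c : ℝ,
      Tendsto (fun l : ℝ => (l + 1) * ∫ u in Icc (0:ℝ) 1, u ^ l * μ u * F l u)
          (nhdsWithin (-1) (Ioi (-1))) (nhds c) ↔
        Tendsto (fun l : ℝ => (l + 1) * ∫ u in Icc (0:ℝ) 1, u ^ l * F l u)
          (nhdsWithin (-1) (Ioi (-1))) (nhds c) := by
  obtain ⟨C, hC⟩ := hFb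
  have hC0 : 0 ≤ C := (abs_nonneg _).trans (hC 0 (by simp) 0 (by simp))
  have hFa : ∀ l ∈ Icc (-1:ℝ) 0, AEStronglyMeasurable (F l) (volume.restrict (Icc 0 1)) :=
    fun l hl => ((aemeasurable_restrict_iff_comap_subtype measurableSet_Icc).2
      (hFm l hl).aemeasurable).aestronglyMeasurable
  have hwi : IntegrableOn (fun u => μ u - 1) (Icc 0 1) :=
    hμint.sub (integrableOn_const (by simp))
  have hnear : ∀ ε > 0, ∃ δ : ℝ, 0 < δ ∧ δ ≤ 1 ∧
      ∀ u ∈ Icc (0:ℝ) 1, u ≤ δ → |μ u - 1| ≤ ε := by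
    intro ε hε
    obtain ⟨δ, hδ, h⟩ := Metric.continuousWithinAt_iff.1 hμc ε hε
    refine ⟨min (δ / 2) 1, by positivity, min_le_right _ _, fun u hu hle => ?_⟩
    have hlt : dist u 0 < δ := by
      rw [Real.dist_0_eq_abs, abs_of_nonneg hu.1]
      linarith [min_le_left (δ / 2) 1]
    simpa [Real.dist_eq, hμ0] using (h hu hlt).le
  have hIoo : ∀ᶠ l in nhdsWithin (-1:ℝ) (Ioi (-1)), l ∈ Ioo (-1:ℝ) 0 :=
    Ioo_mem_nhdsGT (by norm_num)
  have hlim : Tendsto (fun l : ℝ => (l + 1) * ∫ u in Icc (0:ℝ) 1, u ^ l * (μ u - 1) * F l u)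
      (nhdsWithin (-1) (Ioi (-1))) (nhds 0) := by
    rw [Metric.tendsto_nhds]
    intro η hη
    have hε : 0 < η / (2 * (C + 1)) := by positivity
    obtain ⟨δ, hδ, hδ1, hw⟩ := hnear _ hε
    set ε := η / (2 * (C + 1)) with hεdef
    set M := ∫ u in Icc (0:ℝ) 1, |μ u - 1|
    have hCε : C * ε < η := by
      have : (C + 1) * ε = η / 2 := by rw [hεdef]; field_simp
      nlinarith
    have hcont : Tendsto (fun l : ℝ => C * ε + (l + 1) * (C * (δ⁻¹ * M)))
        (nhdsWithin (-1) (Ioi (-1))) (nhds (C * ε)) := by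
      have : Continuous fun l : ℝ => C * ε + (l + 1) * (C * (δ⁻¹ * M)) := by fun_prop
      simpa using (this.tendsto (-1)).mono_left nhdsWithin_le_nhds
    filter_upwards [hIoo, hcont.eventually_lt_const hCε] with l hl hlt
    have hl' := Ioo_subset_Icc_self hl
    have hpos : 0 < l + 1 := by linarith [hl.1]
    have hb := (integrableOn_and_abs_integral_rpow_mul_mul_le hl hδ hδ1 hε.le hwi hw
      (hFa l hl') (hC l hl')).2
    change _ ≤ C * (ε * (1 / (l + 1)) + δ⁻¹ * M) at hb
    rw [Real.dist_0_eq_abs, abs_mul, abs_of_pos hpos]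
    refine (mul_le_mul_of_nonneg_left hb hpos.le).trans_lt (lt_of_eq_of_lt ?_ hlt)
    field_simp
  refine ⟨hlim, fun c => ?_⟩
  obtain ⟨δ, hδ, hδ1, hw⟩ := hnear 1 one_pos
  have hsplit : ∀ᶠ l in nhdsWithin (-1:ℝ) (Ioi (-1)),
      (l + 1) * ∫ u in Icc (0:ℝ) 1, u ^ l * μ u * F l u =
        ((l + 1) * ∫ u in Icc (0:ℝ) 1, u ^ l * (μ u - 1) * F l u) +
          (l + 1) * ∫ u in Icc (0:ℝ) 1, u ^ l * F l u := by
    filter_upwards [hIoo] with l hl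
    have hl' := Ioo_subset_Icc_self hl
    have h1 := (integrableOn_and_abs_integral_rpow_mul_mul_le hl hδ hδ1 zero_le_one hwi hw
      (hFa l hl') (hC l hl')).1
    have h2 : IntegrableOn (fun u => u ^ l * F l u) (Icc 0 1) := by
      simpa using (integrableOn_and_abs_integral_rpow_mul_mul_le (w := fun _ => 1) hl hδ hδ1
        zero_le_one (integrableOn_const (by simp)) (by simp) (hFa l hl') (hC l hl')).1
    rw [← mul_add, ← integral_add h1 h2]
    congr 2 with u
    ring
  rw [tendsto_congr' hsplit]
  refine ⟨fun h => ?_, fun h => ?_⟩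
  · simpa using h.sub hlim
  · simpa using hlim.add h
end

section
/- Let d ∈ {1,2,4} and let p, q be integers with q ≥ p ≥ 1. Let F : [−1,0] × [0,1] → ℝ be bounded, with u ↦ F(λ,u) measurable for each λ. Assume sup_{λ ∈ [−1,0]} |F(λ,u) − F(λ,0)| → 0 as u → 0⁺, and that λ ↦ F(λ,0) is continuous at λ = −1. Then lim_{λ → −1⁺} (λ+1) · ∫_0^1 u^{(d(λ+1)−2)/2} (1−u)^{(d−2+d(q−p))/2} F(λ,u) du = (2/d) · F(−1,0). -/
open MeasureTheory Filter Set

lemma integrableOn_one_sub_rpow {b : ℝ} (hb : -1 < b) :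
    IntegrableOn (fun u : ℝ => (1 - u) ^ b) (Ioo 0 1) := by
  have h := (intervalIntegral.intervalIntegrable_rpow' (a := 0) (b := 1) hb).comp_sub_left 1
  simp only [sub_zero, sub_self] at h
  exact (intervalIntegrable_iff_integrableOn_Ioo_of_le zero_le_one).1 h.symm

lemma integrableOn_rpow_sub_one {ε : ℝ} (hε : 0 < ε) :
    IntegrableOn (fun u : ℝ => u ^ (ε - 1)) (Ioo 0 1) :=
  (intervalIntegrable_iff_integrableOn_Ioo_of_le zero_le_one).1
    (intervalIntegral.intervalIntegrable_rpow' (by linarith))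

lemma mul_integral_rpow_sub_one {ε : ℝ} (hε : 0 < ε) :
    ε * ∫ u in Ioo (0 : ℝ) 1, u ^ (ε - 1) = 1 := by
  rw [← integral_Ioc_eq_integral_Ioo, ← intervalIntegral.integral_of_le zero_le_one,
    integral_rpow (Or.inl (by linarith))]
  simp [hε.ne']

/-- The kernel `ε * u ^ (ε - 1)` on `(0, 1)` concentrates at `0`, with an explicit error bound. -/
lemma abs_mul_integral_rpow_mul_sub_le_s4 {ε c η : ℝ} {g w : ℝ → ℝ} (hε : 0 < ε)
    (hg : AEStronglyMeasurable g (volume.restrict (Ioo 0 1)))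
    (hw : IntegrableOn w (Ioo 0 1)) (hw0 : ∀ u ∈ Ioo (0 : ℝ) 1, 0 ≤ w u)
    (hgw : ∀ u ∈ Ioo (0 : ℝ) 1, |g u - c| ≤ η + w u * u) :
    |ε * (∫ u in Ioo (0 : ℝ) 1, u ^ (ε - 1) * g u) - c| ≤
      η + ε * ∫ u in Ioo (0 : ℝ) 1, w u := by
  have hk := integrableOn_rpow_sub_one hε
  have hbound : ∀ᵐ u ∂volume.restrict (Ioo (0 : ℝ) 1),
      ‖u ^ (ε - 1) * (g u - c)‖ ≤ η * u ^ (ε - 1) + w u := by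
    filter_upwards [ae_restrict_mem measurableSet_Ioo] with u hu
    have hpos : 0 < u ^ (ε - 1) := Real.rpow_pos_of_pos hu.1 _
    have hle : u ^ (ε - 1) * u ≤ 1 := by
      rw [← Real.rpow_add_one hu.1.ne', sub_add_cancel]
      exact Real.rpow_le_one hu.1.le hu.2.le hε.le
    rw [Real.norm_eq_abs, abs_mul, abs_of_pos hpos]
    nlinarith [mul_le_mul_of_nonneg_left (hgw u hu) hpos.le,
      mul_le_mul_of_nonneg_left hle (hw0 u hu)]
  have hdom : IntegrableOn (fun u => η * u ^ (ε - 1) + w u) (Ioo 0 1) := (hk.const_mul η).add hw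
  have hD : IntegrableOn (fun u => u ^ (ε - 1) * (g u - c)) (Ioo 0 1) :=
    Integrable.mono' hdom
      (hk.aestronglyMeasurable.mul (hg.sub aestronglyMeasurable_const)) hbound
  have hsplit : ∫ u in Ioo (0 : ℝ) 1, u ^ (ε - 1) * g u =
      (∫ u in Ioo (0 : ℝ) 1, u ^ (ε - 1) * (g u - c)) +
        (∫ u in Ioo (0 : ℝ) 1, u ^ (ε - 1)) * c := by
    rw [← integral_mul_const, ← integral_add hD (hk.mul_const c)]
    exact integral_congr_ae (Eventually.of_forall fun u => by ring)
  have hle := norm_integral_le_of_norm_le hdom hbound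
  rw [integral_add (hk.const_mul η) hw, integral_const_mul, Real.norm_eq_abs] at hle
  have h1 := mul_integral_rpow_sub_one hε
  have heq : ε * (∫ u in Ioo (0 : ℝ) 1, u ^ (ε - 1) * g u) - c =
      ε * ∫ u in Ioo (0 : ℝ) 1, u ^ (ε - 1) * (g u - c) := by
    rw [hsplit]
    linear_combination c * h1
  rw [heq, abs_mul, abs_of_pos hε]
  calc _ ≤ ε * (η * (∫ u in Ioo (0 : ℝ) 1, u ^ (ε - 1)) + ∫ u in Ioo (0 : ℝ) 1, w u) :=
        mul_le_mul_of_nonneg_left hle hε.le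
    _ = _ := by linear_combination η * h1

/-- Theorem 3.9 of the paper: the main limit theorem computing the analytic
continuation of the normalized cosine-λ transform on Gr(p,𝕂ⁿ) at its first pole λ = -1. -/
theorem main_limit_theorem_first_pole
    (d p q : ℕ) (hd : d = 1 ∨ d = 2 ∨ d = 4) (hp : 1 ≤ p) (hpq : p ≤ q)
    (F : ℝ → ℝ → ℝ)
    (hFb : ∃ C : ℝ, ∀ l ∈ Icc (-1:ℝ) 0, ∀ u ∈ Icc (0:ℝ) 1, |F l u| ≤ C)
    (hFm : ∀ l ∈ Icc (-1:ℝ) 0, Measurable ((Icc (0:ℝ) 1).restrict (F l)))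
    (hFu : Tendsto (fun u : ℝ => ⨆ l : Icc (-1:ℝ) 0, |F l.1 u - F l.1 0|)
      (nhdsWithin 0 (Ioi 0)) (nhds 0))
    (hFc : ContinuousWithinAt (fun l => F l 0) (Icc (-1) 0) (-1)) :
    Tendsto
      (fun l : ℝ => (l + 1) * ∫ u in Icc (0:ℝ) 1,
        u ^ (((d : ℝ) * (l + 1) - 2) / 2) *
          (1 - u) ^ (((d : ℝ) - 2 + (d : ℝ) * ((q : ℝ) - (p : ℝ))) / 2) * F l u)
      (nhdsWithin (-1) (Ioi (-1))) (nhds ((2 / (d : ℝ)) * F (-1) 0)) := by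
  obtain ⟨C, hC⟩ := hFb
  have hd1 : (1 : ℝ) ≤ d := by exact_mod_cast (by omega : 1 ≤ d)
  have hpq' : (p : ℝ) ≤ q := by exact_mod_cast hpq
  set b : ℝ := ((d : ℝ) - 2 + (d : ℝ) * ((q : ℝ) - (p : ℝ))) / 2 with hb_def
  have hb : -1 < b := by
    have : 0 ≤ (d : ℝ) * ((q : ℝ) - p) := mul_nonneg (by linarith) (by linarith)
    rw [hb_def]; linarith
  have hC0 : 0 ≤ C :=
    (abs_nonneg _).trans (hC 0 (by simp) 0 (by simp))
  have hw := integrableOn_one_sub_rpow hb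
  have hw0 : ∀ u ∈ Ioo (0 : ℝ) 1, 0 ≤ (1 - u) ^ b := fun u hu =>
    Real.rpow_nonneg (by linarith [hu.2]) _
  have hw1 : Tendsto (fun u : ℝ => (1 - u) ^ b) (nhdsWithin 0 (Ioi 0)) (nhds 1) := by
    have h : ContinuousAt (fun u : ℝ => (1 - u) ^ b) 0 :=
      ContinuousAt.rpow_const (by fun_prop) (Or.inl (by norm_num))
    have h' := h.tendsto
    simp only [sub_zero, Real.one_rpow] at h'
    exact h'.mono_left nhdsWithin_le_nhds
  have hsup : ∀ l ∈ Icc (-1 : ℝ) 0, ∀ u ∈ Icc (0 : ℝ) 1,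
      |F l u - F l 0| ≤ ⨆ l : Icc (-1 : ℝ) 0, |F l.1 u - F l.1 0| := fun l hl u hu =>
    le_ciSup (f := fun l : Icc (-1 : ℝ) 0 => |F l.1 u - F l.1 0|)
      ⟨C + C, by
        rintro _ ⟨m, rfl⟩
        exact (abs_sub _ _).trans (add_le_add (hC m m.2 u hu) (hC m m.2 0 (by simp)))⟩ ⟨l, hl⟩
  have herr : Tendsto (fun u : ℝ => (1 - u) ^ b * (⨆ l : Icc (-1 : ℝ) 0, |F l.1 u - F l.1 0|) +
      |(1 - u) ^ b - 1| * C) (nhdsWithin 0 (Ioi 0)) (nhds 0) := by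
    simpa using (hw1.mul hFu).add ((hw1.sub_const 1).abs.mul_const C)
  have hε : Tendsto (fun l : ℝ => (d : ℝ) * (l + 1) / 2) (nhdsWithin (-1) (Ioi (-1))) (nhds 0) := by
    have h : ContinuousAt (fun l : ℝ => (d : ℝ) * (l + 1) / 2) (-1) := by fun_prop
    have h' := h.tendsto
    norm_num at h'
    exact h'.mono_left nhdsWithin_le_nhds
  have hl_mem : ∀ᶠ l : ℝ in nhdsWithin (-1) (Ioi (-1)), l ∈ Ioc (-1 : ℝ) 0 :=
    Ioc_mem_nhdsGT (by norm_num)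
  have hmain : Tendsto (fun l : ℝ => (d : ℝ) * (l + 1) / 2 *
      (∫ u in Ioo (0 : ℝ) 1, u ^ ((d : ℝ) * (l + 1) / 2 - 1) * ((1 - u) ^ b * F l u)) - F l 0)
      (nhdsWithin (-1) (Ioi (-1))) (nhds 0) := by
    rw [Metric.tendsto_nhds]
    intro η hη
    obtain ⟨δ, hδ : 0 < δ, hδη⟩ := mem_nhdsGT_iff_exists_Ioo_subset.1
      (herr.eventually (gt_mem_nhds (half_pos hη)))
    have hW : IntegrableOn (fun u : ℝ => C / δ * ((1 - u) ^ b + 1)) (Ioo 0 1) :=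
      (hw.add (integrableOn_const (by simp))).const_mul _
    have hsmall := (hε.mul_const (∫ u in Ioo (0 : ℝ) 1, C / δ * ((1 - u) ^ b + 1))).eventually
      (gt_mem_nhds ((zero_mul _).trans_lt (half_pos hη)))
    filter_upwards [hl_mem, hsmall] with l hl hlη
    have hl' : l ∈ Icc (-1 : ℝ) 0 := Ioc_subset_Icc_self hl
    rw [dist_zero_right, Real.norm_eq_abs]
    refine (abs_mul_integral_rpow_mul_sub_le_s4 (η := η / 2)
      (w := fun u => C / δ * ((1 - u) ^ b + 1)) ?_ ?_ hW ?_ ?_).trans_lt (by linarith)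
    · have : 0 < l + 1 := by linarith [hl.1]
      positivity
    · refine hw.aestronglyMeasurable.mul (AEMeasurable.aestronglyMeasurable ?_)
      exact ((aemeasurable_restrict_iff_comap_subtype measurableSet_Icc).2
        (hFm l hl').aemeasurable).mono_measure (Measure.restrict_mono Ioo_subset_Icc_self le_rfl)
    · intro u hu
      have := hw0 u hu
      positivity
    · intro u hu
      have hwu := hw0 u hu
      have hu' := Ioo_subset_Icc_self hu
      have hF0 := hC l hl' 0 (by simp)
      rcases lt_or_ge u δ with huδ | huδ
      · have h1 : _ < η / 2 := hδη ⟨hu.1, huδ⟩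
        have h2 : |(1 - u) ^ b * F l u - F l 0| ≤
            (1 - u) ^ b * |F l u - F l 0| + |(1 - u) ^ b - 1| * |F l 0| := by
          rw [← abs_of_nonneg hwu, ← abs_mul, abs_of_nonneg hwu, ← abs_mul]
          refine le_of_eq_of_le ?_ (abs_add_le _ _)
          ring_nf
        have h3 := mul_le_mul_of_nonneg_left (hsup l hl' u hu') hwu
        have h4 := mul_le_mul_of_nonneg_left hF0 (abs_nonneg ((1 - u) ^ b - 1))
        have h5 : 0 ≤ C / δ * ((1 - u) ^ b + 1) * u := by
          have := hu.1
          positivity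
        linarith
      · have h1 : |(1 - u) ^ b * F l u - F l 0| ≤ C * ((1 - u) ^ b + 1) := by
          refine (abs_sub _ _).trans ?_
          rw [abs_mul, abs_of_nonneg hwu]
          nlinarith [mul_le_mul_of_nonneg_left (hC l hl' u hu') hwu]
        have h2 : C * ((1 - u) ^ b + 1) ≤ C / δ * ((1 - u) ^ b + 1) * u := by
          have h3 : 1 ≤ u / δ := (one_le_div hδ).2 huδ
          calc _ ≤ C * ((1 - u) ^ b + 1) * (u / δ) := le_mul_of_one_le_right (by positivity) h3
            _ = _ := by ring
        linarith
  have hF0 : Tendsto (fun l => F l 0) (nhdsWithin (-1) (Ioi (-1))) (nhds (F (-1) 0)) :=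
    hFc.tendsto.mono_left (le_inf nhdsWithin_le_nhds
      (le_principal_iff.2 (hl_mem.mono fun _ h => Ioc_subset_Icc_self h)))
  have hlim := (hmain.add hF0).const_mul (2 / (d : ℝ))
  rw [zero_add] at hlim
  refine hlim.congr fun l => ?_
  have hexp : ((d : ℝ) * (l + 1) - 2) / 2 = (d : ℝ) * (l + 1) / 2 - 1 := by ring
  rw [integral_Icc_eq_integral_Ioo, hexp]
  simp only [mul_assoc, sub_add_cancel]
  field_simp
end

section
/- Let p, q be integers with q ≥ p ≥ 1, n = p + q, and let 𝕜 be ℝ or ℂ. For t = (t₁,…,t_p) ∈ ℝ^p, let M(t) be the n × n matrix over 𝕜 with real entries given by: M(t)_{i,i} = cos(t_i) and M(t)_{n+1−i,n+1−i} = cos(t_i) and M(t)_{i,n+1−i} = −sin(t_i) and M(t)_{n+1−i,i} = sin(t_i) for 1 ≤ i ≤ p, M(t)_{j,j} = 1 for p < j ≤ q, and all other entries 0 (indices 1,…,n; M(t) acts as the rotation by angle t_i in the coordinate plane spanned by e_i and e_{n+1−i}). Let β = span_𝕜{e₁,…,e_p} ⊆ 𝕜ⁿ. Then for all s, t ∈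 ℝ^p, the image subspace M(t)·β equals M(s)·β if and only if for every i ∈ {1,…,p} there is an integer k_i with t_i − s_i = k_i·π. In particular, M(t)·β = β if and only if every t_i is an integer multiple of π. -/
/-- The matrix `exp Y(t)` of the polar-coordinate parametrization of the Grassmannian:
it acts as rotation by angle `t_i` in the coordinate plane spanned by `e_i` and
`e_{n+1-i}` (1-based indices), for `1 ≤ i ≤ p`, and as the identity on the remaining
coordinates (`n = p + q`). -/
noncomputable def rotMat (𝕜 : Type*) [RCLike 𝕜] (p q : ℕ) (t : Fin p → ℝ) :
    Matrix (Fin (p + q)) (Fin (p + q)) 𝕜 :=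
  Matrix.of fun i j =>
    if hi : (i : ℕ) < p then
      if (j : ℕ) = (i : ℕ) then (Real.cos (t ⟨i, hi⟩) : 𝕜)
      else if (j : ℕ) = p + q - 1 - (i : ℕ) then (-(Real.sin (t ⟨i, hi⟩)) : 𝕜)
      else 0
    else if hk : p + q - 1 - (i : ℕ) < p then
      if (j : ℕ) = (i : ℕ) then (Real.cos (t ⟨p + q - 1 - (i : ℕ), hk⟩) : 𝕜)
      else if (j : ℕ) = p + q - 1 - (i : ℕ) then (Real.sin (t ⟨p + q - 1 - (i : ℕ), hk⟩) : 𝕜)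
      else 0
    else if (j : ℕ) = (i : ℕ) then 1 else 0

/-- The subspace `β = span{e₁, …, e_p}` of `𝕜ⁿ`. -/
def stdSubspace (𝕜 : Type*) [RCLike 𝕜] (n p : ℕ) : Submodule 𝕜 (Fin n → 𝕜) :=
  Submodule.span 𝕜 {v | ∃ i : Fin n, (i : ℕ) < p ∧ v = Pi.single i 1}

/-- The image under `rotMat 𝕜 p q t` of the `i`-th standard basis vector, for `i < p`. -/
noncomputable def rotVec (𝕜 : Type*) [RCLike 𝕜] (p q : ℕ) (t : Fin p → ℝ) (i : Fin p) :
    Fin (p + q) → 𝕜 :=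
  Pi.single (Fin.castAdd q i) (Real.cos (t i) : 𝕜) +
    Pi.single (Fin.castAdd q i).rev (Real.sin (t i) : 𝕜)

lemma rotMat_mulVec_single {𝕜 : Type*} [RCLike 𝕜] {p q : ℕ} (hpq : p ≤ q) (t : Fin p → ℝ)
    (i : Fin p) :
    (rotMat 𝕜 p q t).mulVec (Pi.single (Fin.castAdd q i) 1) = rotVec 𝕜 p q t i := by
  ext r
  have hi := i.isLt
  have hr := r.isLt
  simp only [Matrix.mulVec_single_one, Matrix.col_apply, rotMat, Matrix.of_apply, rotVec,
    Pi.add_apply, Pi.single_apply, Fin.ext_iff, Fin.val_castAdd, Fin.val_rev]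
  by_cases h1 : (r : ℕ) = i
  · have h2 : (r : ℕ) ≠ p + q - (i + 1) := by omega
    simp [h1, h1 ▸ h2]
  · by_cases h2 : (r : ℕ) = p + q - (i + 1)
    · have h3 : ¬ (r : ℕ) < p := by omega
      have h4 : p + q - 1 - (r : ℕ) = i := by omega
      have h5 : (i : ℕ) ≠ r := by omega
      simp only [h3, h4, h5, h1, h2.symm, hi, dite_true, dite_false, if_true, if_false, zero_add]
    · have h3 : (i : ℕ) ≠ p + q - 1 - (r : ℕ) := by omega
      have h4 : (i : ℕ) ≠ r := by omega
      simp [h1, h2, h3, h4]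

lemma stdSubspace_eq_span_range (𝕜 : Type*) [RCLike 𝕜] (p q : ℕ) :
    stdSubspace 𝕜 (p + q) p =
      Submodule.span 𝕜 (Set.range fun i : Fin p ↦ (Pi.single (Fin.castAdd q i) 1 : Fin (p + q) → 𝕜)) := by
  unfold stdSubspace
  congr 1
  ext v
  constructor
  · rintro ⟨i, hi, rfl⟩
    exact ⟨⟨i, hi⟩, rfl⟩
  · rintro ⟨i, rfl⟩
    exact ⟨Fin.castAdd q i, i.isLt, rfl⟩

lemma map_rotMat_stdSubspace {𝕜 : Type*} [RCLike 𝕜] {p q : ℕ} (hpq : p ≤ q) (t : Fin p → ℝ) :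
    Submodule.map (Matrix.toLin' (rotMat 𝕜 p q t)) (stdSubspace 𝕜 (p + q) p) =
      Submodule.span 𝕜 (Set.range (rotVec 𝕜 p q t)) := by
  rw [stdSubspace_eq_span_range, Submodule.map_span, ← Set.range_comp]
  congr 2
  ext1 i
  simp only [Function.comp_apply, Matrix.toLin'_apply, rotMat_mulVec_single hpq]

lemma span_rotVec_zero (𝕜 : Type*) [RCLike 𝕜] (p q : ℕ) :
    Submodule.span 𝕜 (Set.range (rotVec 𝕜 p q 0)) = stdSubspace 𝕜 (p + q) p := by
  rw [stdSubspace_eq_span_range]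
  congr 2
  ext1 i
  simp [rotVec]

lemma rotVec_apply_castAdd {𝕜 : Type*} [RCLike 𝕜] {p q : ℕ} (hpq : p ≤ q) (t : Fin p → ℝ)
    (i j : Fin p) :
    rotVec 𝕜 p q t i (Fin.castAdd q j) = if j = i then (Real.cos (t i) : 𝕜) else 0 := by
  have h : (j : ℕ) ≠ p + q - (i + 1) := by omega
  simp [rotVec, Pi.single_apply, Fin.ext_iff, h]

lemma rotVec_apply_rev_castAdd {𝕜 : Type*} [RCLike 𝕜] {p q : ℕ} (hpq : p ≤ q) (t : Fin p → ℝ)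
    (i j : Fin p) :
    rotVec 𝕜 p q t i (Fin.castAdd q j).rev = if j = i then (Real.sin (t i) : 𝕜) else 0 := by
  have h : p + q - (j + 1) ≠ (i : ℕ) := by omega
  have h' : (p + q - (j + 1) = p + q - (i + 1)) ↔ (j : ℕ) = i := by omega
  simp [rotVec, Pi.single_apply, Fin.ext_iff, h, h']

lemma span_rotVec_le_iff {𝕜 : Type*} [RCLike 𝕜] {p q : ℕ} (hpq : p ≤ q) (s t : Fin p → ℝ) :
    Submodule.span 𝕜 (Set.range (rotVec 𝕜 p q t)) ≤
        Submodule.span 𝕜 (Set.range (rotVec 𝕜 p q s)) ↔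
      ∀ i, ∃ k : ℤ, t i - s i = k * Real.pi := by
  rw [Submodule.span_le, Set.range_subset_iff]
  refine forall_congr' fun i ↦ ⟨fun h ↦ ?_, ?_⟩
  · let f : (Fin (p + q) → 𝕜) →ₗ[𝕜] 𝕜 :=
      (Real.cos (s i) : 𝕜) • LinearMap.proj (Fin.castAdd q i).rev -
        (Real.sin (s i) : 𝕜) • LinearMap.proj (Fin.castAdd q i)
    have hf : Submodule.span 𝕜 (Set.range (rotVec 𝕜 p q s)) ≤ LinearMap.ker f := by
      rw [Submodule.span_le, Set.range_subset_iff]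
      intro j
      by_cases hij : i = j
      · subst hij
        simp [f, rotVec_apply_castAdd hpq, rotVec_apply_rev_castAdd hpq, mul_comm]
      · simp [f, rotVec_apply_castAdd hpq, rotVec_apply_rev_castAdd hpq, hij]
    have hfi : f (rotVec 𝕜 p q t i) = 0 := hf h
    simp only [f, LinearMap.sub_apply, LinearMap.smul_apply, LinearMap.proj_apply, smul_eq_mul,
      rotVec_apply_castAdd hpq, rotVec_apply_rev_castAdd hpq, if_true] at hfi
    have hsin : Real.sin (t i - s i) = 0 := by
      rw [Real.sin_sub]
      have : Real.cos (s i) * Real.sin (t i) - Real.sin (s i) * Real.cos (t i) = 0 := by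
        exact_mod_cast hfi
      linarith
    obtain ⟨k, hk⟩ := Real.sin_eq_zero_iff.mp hsin
    exact ⟨k, hk.symm⟩
  · rintro ⟨k, hk⟩
    have hti : t i = s i + k * Real.pi := by linarith
    have : rotVec 𝕜 p q t i = ((-1 : 𝕜) ^ k) • rotVec 𝕜 p q s i := by
      simp only [rotVec, hti, Real.cos_add_int_mul_pi, Real.sin_add_int_mul_pi, smul_add,
        ← Pi.single_smul, smul_eq_mul]
      push_cast
      rfl
    rw [this]
    exact Submodule.smul_mem _ _ (Submodule.subset_span ⟨i, rfl⟩)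

lemma span_rotVec_eq_iff {𝕜 : Type*} [RCLike 𝕜] {p q : ℕ} (hpq : p ≤ q) (s t : Fin p → ℝ) :
    Submodule.span 𝕜 (Set.range (rotVec 𝕜 p q t)) =
        Submodule.span 𝕜 (Set.range (rotVec 𝕜 p q s)) ↔
      ∀ i, ∃ k : ℤ, t i - s i = k * Real.pi := by
  rw [le_antisymm_iff, span_rotVec_le_iff hpq, span_rotVec_le_iff hpq, and_iff_left_iff_imp]
  intro h i
  obtain ⟨k, hk⟩ := h i
  exact ⟨-k, by push_cast; linarith⟩


/-- the map `t ↦ exp Y(t)·β` is π-periodic in each variable and injective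
modulo π: `M(t)·β = M(s)·β` iff each `t_i - s_i` is an integer multiple of π; in
particular `M(t)·β = β` iff each `t_i` is an integer multiple of π. -/
theorem rotMat_image_eq_iff_pi_congruent
    (𝕜 : Type*) [RCLike 𝕜] (p q : ℕ) (hp : 1 ≤ p) (hpq : p ≤ q) :
    (∀ s t : Fin p → ℝ,
      Submodule.map (Matrix.toLin' (rotMat 𝕜 p q t)) (stdSubspace 𝕜 (p + q) p) =
          Submodule.map (Matrix.toLin' (rotMat 𝕜 p q s)) (stdSubspace 𝕜 (p + q) p) ↔
        ∀ i : Fin p, ∃ k : ℤ, t i - s i = k * Real.pi) ∧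
    (∀ t : Fin p → ℝ,
      Submodule.map (Matrix.toLin' (rotMat 𝕜 p q t)) (stdSubspace 𝕜 (p + q) p) =
          stdSubspace 𝕜 (p + q) p ↔
        ∀ i : Fin p, ∃ k : ℤ, t i = k * Real.pi) := by
  refine ⟨fun s t ↦ ?_, fun t ↦ ?_⟩
  · rw [map_rotMat_stdSubspace hpq, map_rotMat_stdSubspace hpq, span_rotVec_eq_iff hpq]
  · rw [map_rotMat_stdSubspace hpq, ← span_rotVec_zero, span_rotVec_eq_iff hpq]
    simp
end

section
/- Let 𝕜 be ℝ or ℂ, let p, q be integers with q ≥ p ≥ 1, n = p + q, let E = 𝕜ⁿ with its standard inner product and standard basis e₁,…,e_n, and let β = span{e₁,…,e_p}. Then for every p-dimensional subspace σ ⊆ E, the following are equivalent: (1) σ ∩ β^⊥ ≠ {0} (i.e. σ contains a nonzero vector orthogonal to β, equivalently |Cos(σ,β)| = 0, i.e. σ ∈ Z(β)); (2) there exists a linear isometric automorphism l of E with l(β) = β such that e_n ∈ l(σ) and l(σ) ⊆ (𝕜·e₁)^⊥. -/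
open Module

/-- The subspace `β = span{e₁, …, e_p}` of `𝕜ⁿ` spanned by the first `p` standard basis
vectors. -/
noncomputable def stdFlag (𝕜 : Type*) [RCLike 𝕜] (n p : ℕ) :
    Submodule 𝕜 (EuclideanSpace 𝕜 (Fin n)) :=
  Submodule.span 𝕜 {v | ∃ i : Fin n, (i : ℕ) < p ∧ v = EuclideanSpace.single i 1}

/-- If `σ` and `β` have the same finite dimension and `σ` contains a nonzero vector orthogonal
to `β`, then `β` contains a nonzero vector orthogonal to `σ`. -/
theorem Submodule.exists_mem_orthogonal_of_finrank_eq {𝕜 E : Type*} [RCLike 𝕜]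
    [NormedAddCommGroup E] [InnerProductSpace 𝕜 E] [FiniteDimensional 𝕜 E]
    {σ β : Submodule 𝕜 E} (h : finrank 𝕜 σ = finrank 𝕜 β) {u : E} (hu : u ∈ σ)
    (huβ : u ∈ βᗮ) (hu0 : u ≠ 0) : ∃ w ∈ β, w ∈ σᗮ ∧ w ≠ 0 := by
  let f : σ →ₗ[𝕜] β := β.orthogonalProjectionOnto.toLinearMap ∘ₗ σ.subtype
  have hf : ¬ Function.Surjective f := by
    rw [← LinearMap.injective_iff_surjective_of_finrank_eq_finrank h]
    intro hinj
    have h0 : f ⟨u, hu⟩ = f 0 := by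
      simpa [f] using β.orthogonalProjectionOnto_apply_of_mem_orthogonal huβ
    exact hu0 (congrArg Subtype.val (hinj h0))
  have hr : (LinearMap.range f)ᗮ ≠ ⊥ := by
    rwa [Ne, Submodule.orthogonal_eq_bot_iff, LinearMap.range_eq_top]
  obtain ⟨w, hw, hw0⟩ := Submodule.exists_mem_ne_zero_of_ne_bot hr
  refine ⟨w, w.2, fun s hs => ?_, by simpa using hw0⟩
  have := hw (f ⟨s, hs⟩) ⟨_, rfl⟩
  simpa [f] using this

theorem single_mem_stdFlag (𝕜 : Type*) [RCLike 𝕜] {n p : ℕ} {i : Fin n} (hi : (i : ℕ) < p) :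
    EuclideanSpace.single i (1 : 𝕜) ∈ stdFlag 𝕜 n p :=
  Submodule.subset_span ⟨i, hi, rfl⟩

theorem single_mem_stdFlag_orthogonal (𝕜 : Type*) [RCLike 𝕜] {n p : ℕ} {i : Fin n}
    (hi : p ≤ (i : ℕ)) : EuclideanSpace.single i (1 : 𝕜) ∈ (stdFlag 𝕜 n p)ᗮ := by
  suffices h : stdFlag 𝕜 n p ≤ (𝕜 ∙ EuclideanSpace.single i (1 : 𝕜))ᗮ from
    fun x hx => Submodule.mem_orthogonal_singleton_iff_inner_left.mp (h hx)
  refine Submodule.span_le.mpr ?_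
  rintro _ ⟨j, hj, rfl⟩
  have hij : i ≠ j := by
    rintro rfl
    omega
  exact Submodule.mem_orthogonal_singleton_iff_inner_left.mpr
    (EuclideanSpace.orthonormal_single.2 hij.symm)

theorem finrank_stdFlag (𝕜 : Type*) [RCLike 𝕜] {n p : ℕ} (h : p ≤ n) :
    finrank 𝕜 (stdFlag 𝕜 n p) = p := by
  have hrange : {v | ∃ i : Fin n, (i : ℕ) < p ∧ v = EuclideanSpace.single i (1 : 𝕜)} =
      Set.range fun i : Fin p => EuclideanSpace.single (Fin.castLE h i) (1 : 𝕜) := by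
    ext v
    constructor
    · rintro ⟨i, hi, rfl⟩
      exact ⟨⟨i, hi⟩, rfl⟩
    · rintro ⟨i, rfl⟩
      exact ⟨Fin.castLE h i, i.2, rfl⟩
  have hli : LinearIndependent 𝕜
      fun i : Fin p => EuclideanSpace.single (Fin.castLE h i) (1 : 𝕜) :=
    ((EuclideanSpace.orthonormal_single (𝕜 := 𝕜) (ι := Fin n)).comp _
      (Fin.castLE_injective h)).linearIndependent
  rw [stdFlag, hrange, finrank_span_eq_card hli, Fintype.card_fin]

/-- Given unit vectors `w ∈ β` and `u ∈ βᗮ` there is an orthonormal basis of `𝕜ⁿ` whose first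
`p` members lie in `β = stdFlag 𝕜 n p`, the prescribed one `j` among these being `w`, and whose
prescribed member `k` beyond them is `u`. -/
theorem exists_orthonormalBasis_adapted_stdFlag {𝕜 : Type*} [RCLike 𝕜] {n p : ℕ} {j k : Fin n}
    (hj : (j : ℕ) < p) (hk : p ≤ (k : ℕ)) {u w : EuclideanSpace 𝕜 (Fin n)}
    (hw : w ∈ stdFlag 𝕜 n p) (hu : u ∈ (stdFlag 𝕜 n p)ᗮ) (hw1 : ‖w‖ = 1) (hu1 : ‖u‖ = 1) :
    ∃ b : OrthonormalBasis (Fin n) 𝕜 (EuclideanSpace 𝕜 (Fin n)),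
      (∀ i : Fin n, (i : ℕ) < p → b i ∈ stdFlag 𝕜 n p) ∧ b j = w ∧ b k = u := by
  have hpn : p ≤ n := hk.trans k.2.le
  let w' : stdFlag 𝕜 n p := ⟨w, hw⟩
  have how : Orthonormal 𝕜 (({⟨j, hj⟩} : Set (Fin p)).domRestrict fun _ => w') :=
    ⟨fun _ => hw1, fun x y hxy => absurd (Subsingleton.elim x y) hxy⟩
  obtain ⟨c, hc⟩ := how.exists_orthonormalBasis_extension_of_card_eq
    (by rw [finrank_stdFlag 𝕜 hpn, Fintype.card_fin])
  let v : Fin n → EuclideanSpace 𝕜 (Fin n) := fun i => if h : (i : ℕ) < p then c ⟨i, h⟩ else u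
  have hvlt (i : Fin n) (h : (i : ℕ) < p) : v i = c ⟨i, h⟩ := dif_pos h
  have hvk : v k = u := dif_neg (by omega)
  have hov : Orthonormal 𝕜 (({i | (i : ℕ) < p ∨ i = k} : Set (Fin n)).domRestrict v) := by
    refine ⟨?_, ?_⟩
    · rintro ⟨i, hi | rfl⟩
      · have := c.orthonormal.1 ⟨i, hi⟩
        rwa [Submodule.coe_norm, ← hvlt i hi] at this
      · simpa [hvk] using hu1
    · rintro ⟨i, hi | rfl⟩ ⟨i', hi' | rfl⟩ hne
      · have := c.orthonormal.2 (i := ⟨i, hi⟩) (j := ⟨i', hi'⟩)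
          (by simpa [Fin.ext_iff] using hne)
        simpa [hvlt i hi, hvlt i' hi'] using this
      · simpa [hvlt i hi, hvk] using hu _ (c ⟨i, hi⟩).2
      · simpa [hvlt i' hi', hvk] using
          Submodule.inner_left_of_mem_orthogonal (c ⟨i', hi'⟩).2 hu
      · exact absurd rfl hne
  obtain ⟨b, hb⟩ := hov.exists_orthonormalBasis_extension_of_card_eq (by simp)
  refine ⟨b, fun i hi => ?_, ?_, ?_⟩
  · rw [hb i (Or.inl hi), hvlt i hi]
    exact (c ⟨i, hi⟩).2
  · rw [hb j (Or.inl hj), hvlt j hj, hc _ rfl]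
  · rw [hb k (Or.inr rfl), hvk]

/-- the decomposition `Z(β) = L·B₁`: a `p`-dimensional subspace σ contains a
nonzero vector orthogonal to `β = span{e₁,…,e_p}` iff some unitary map `l` fixing β
carries σ into the embedded lower-rank Grassmannian
`B₁ = {σ' : e_n ∈ σ', σ' ⊆ e₁^⊥}`. -/
theorem zero_set_is_orbit_of_lower_grassmannian
    (𝕜 : Type*) [RCLike 𝕜] (p q : ℕ) (hp : 1 ≤ p) (hpq : p ≤ q)
    (σ : Submodule 𝕜 (EuclideanSpace 𝕜 (Fin (p + q)))) (hσ : finrank 𝕜 σ = p) :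
    σ ⊓ (stdFlag 𝕜 (p + q) p)ᗮ ≠ ⊥ ↔
      ∃ l : EuclideanSpace 𝕜 (Fin (p + q)) ≃ₗᵢ[𝕜] EuclideanSpace 𝕜 (Fin (p + q)),
        Submodule.map l.toLinearEquiv.toLinearMap (stdFlag 𝕜 (p + q) p) =
            stdFlag 𝕜 (p + q) p ∧
        EuclideanSpace.single (⟨p + q - 1, by omega⟩ : Fin (p + q)) (1 : 𝕜) ∈
            Submodule.map l.toLinearEquiv.toLinearMap σ ∧
        Submodule.map l.toLinearEquiv.toLinearMap σ ≤
            (𝕜 ∙ (EuclideanSpace.single (⟨0, by omega⟩ : Fin (p + q)) (1 : 𝕜)))ᗮ := by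
  constructor
  · intro h
    obtain ⟨u, ⟨huσ, huβ⟩, hu0⟩ := Submodule.exists_mem_ne_zero_of_ne_bot h
    obtain ⟨w, hwβ, hwσ, hw0⟩ := Submodule.exists_mem_orthogonal_of_finrank_eq
      (hσ.trans (finrank_stdFlag 𝕜 (Nat.le_add_right p q)).symm) huσ huβ hu0
    obtain ⟨b, hbβ, hbw, hbu⟩ := exists_orthonormalBasis_adapted_stdFlag
      (j := (⟨0, by omega⟩ : Fin (p + q))) (k := (⟨p + q - 1, by omega⟩ : Fin (p + q)))
      (by simp only; omega) (by simp only; omega)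
      (Submodule.smul_mem _ ((‖w‖⁻¹ : ℝ) : 𝕜) hwβ) (Submodule.smul_mem _ ((‖u‖⁻¹ : ℝ) : 𝕜) huβ)
      (by simpa using norm_smul_inv_norm (𝕜 := 𝕜) hw0)
      (by simpa using norm_smul_inv_norm (𝕜 := 𝕜) hu0)
    refine ⟨b.repr, ?_, ?_, ?_⟩
    · symm
      refine Submodule.eq_of_le_of_finrank_eq ?_ ?_
      · refine Submodule.span_le.mpr ?_
        rintro _ ⟨i, hi, rfl⟩
        exact ⟨b i, hbβ i hi, b.repr_self i⟩
      · exact (LinearEquiv.finrank_map_eq b.repr.toLinearEquiv _).symm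
    · exact ⟨_, Submodule.smul_mem _ _ huσ, by rw [← hbu]; exact b.repr_self _⟩
    · rintro _ ⟨s, hs, rfl⟩
      rw [Submodule.mem_orthogonal_singleton_iff_inner_right, ← b.repr_self, hbw]
      exact (b.repr.inner_map_map _ _).trans
        (Submodule.inner_left_of_mem_orthogonal hs (Submodule.smul_mem _ _ hwσ))
  · rintro ⟨l, hl, ⟨u, hu, hlu⟩, -⟩
    refine (Submodule.ne_bot_iff _).mpr ⟨u, ⟨hu, fun x hx => ?_⟩, ?_⟩
    · have hlx : l x ∈ stdFlag 𝕜 (p + q) p := hl ▸ Submodule.mem_map_of_mem hx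
      rw [← l.inner_map_map, show l u = _ from hlu]
      exact single_mem_stdFlag_orthogonal 𝕜 (by simp only; omega) _ hlx
    · rintro rfl
      simpa using hlu.symm
end

section
/- Let p, q be integers with q ≥ p ≥ 2, n = p + q, d ∈ {1,2,4}, and let μ = (m₁,…,m_p) ∈ Λ⁺(B). Define, for real λ at which all Gamma arguments below are not nonpositive integers, R(λ) = ∏_{j=1}^p [Γ(−dλ/2 − d(j−1)/2 + m_j/2) / Γ(−dλ/2 − d(j−1)/2)] · [Γ(d(λ+n)/2 − d(j−1)/2) / Γ(d(λ+n)/2 − d(j−1)/2 + m_j/2)]. Then R(λ) has a finite limit as λ → −1 (along the punctured neighborhood of −1 intersected with the domain of R), and this limit is nonzero if and only if m₂ = m₃ = ⋯ = m_p = 0. -/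
open Filter Set

/-- `x` is a nonpositive integer (a pole of the Gamma function). -/
def IsNonposInt (x : ℝ) : Prop := ∃ k : ℕ, x = -(k : ℝ)

/-- The ratio `η_μ(λ)/η_0(λ)` (up to sign) of eigenvalues of the cosine-λ transform on
`Gr(p, 𝕂^{p+q})`, `d = dim_ℝ 𝕂`, for the weight `μ = m`. -/
noncomputable def Rfun (d p q : ℕ) (m : Fin p → ℤ) (l : ℝ) : ℝ :=
  ∏ j : Fin p,
    (Real.Gamma (-(d : ℝ) * l / 2 - (d : ℝ) * ((j : ℕ) : ℝ) / 2 + (m j : ℝ) / 2) /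
        Real.Gamma (-(d : ℝ) * l / 2 - (d : ℝ) * ((j : ℕ) : ℝ) / 2)) *
      (Real.Gamma ((d : ℝ) * (l + (p : ℝ) + (q : ℝ)) / 2 - (d : ℝ) * ((j : ℕ) : ℝ) / 2) /
        Real.Gamma
          ((d : ℝ) * (l + (p : ℝ) + (q : ℝ)) / 2 - (d : ℝ) * ((j : ℕ) : ℝ) / 2 +
            (m j : ℝ) / 2))

/-- Domain of `Rfun`: the set of real `λ` at which none of the Gamma arguments appearing
in `Rfun` is a nonpositive integer. -/
def RDom (d p q : ℕ) (m : Fin p → ℤ) : Set ℝ :=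
  {l | ∀ j : Fin p,
    ¬ IsNonposInt (-(d : ℝ) * l / 2 - (d : ℝ) * ((j : ℕ) : ℝ) / 2 + (m j : ℝ) / 2) ∧
    ¬ IsNonposInt (-(d : ℝ) * l / 2 - (d : ℝ) * ((j : ℕ) : ℝ) / 2) ∧
    ¬ IsNonposInt ((d : ℝ) * (l + (p : ℝ) + (q : ℝ)) / 2 - (d : ℝ) * ((j : ℕ) : ℝ) / 2) ∧
    ¬ IsNonposInt
        ((d : ℝ) * (l + (p : ℝ) + (q : ℝ)) / 2 - (d : ℝ) * ((j : ℕ) : ℝ) / 2 +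
          (m j : ℝ) / 2)}

/-- Membership in `Λ⁺(B)`: all `m_i` even, `m₁ ≥ m₂ ≥ ⋯ ≥ m_{p-1} ≥ |m_p|`, and
`m_p ≥ 0` unless `d = 1` and `p = q`. -/
def LambdaPlus (d p q : ℕ) (m : Fin p → ℤ) : Prop :=
  (∀ i, 2 ∣ m i) ∧ (∀ i j : Fin p, i < j → |m j| ≤ m i) ∧
    (¬(d = 1 ∧ p = q) → ∀ i, 0 ≤ m i)

theorem Real.Gamma_add_natCast_eq_ascPochhammer_eval_mul {x : ℝ} (hx : ¬ IsNonposInt x) (k : ℕ) :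
    Real.Gamma (x + k) = (ascPochhammer ℝ k).eval x * Real.Gamma x := by
  induction k with
  | zero => simp
  | succ k ih =>
    have hne : x + k ≠ 0 := fun h => hx ⟨k, by linarith⟩
    rw [Nat.cast_succ, ← add_assoc, Real.Gamma_add_one hne, ih, ascPochhammer_succ_eval]
    ring

theorem Real.Gamma_ne_zero_of_not_isNonposInt {x : ℝ} (hx : ¬ IsNonposInt x) : Real.Gamma x ≠ 0 :=
  Real.Gamma_ne_zero fun k hk => hx ⟨k, hk⟩

theorem ascPochhammer_eval_ne_zero_of_pos {x : ℝ} (hx : 0 < x) (k : ℕ) :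
    (ascPochhammer ℝ k).eval x ≠ 0 :=
  (ascPochhammer_pos k x hx).ne'

theorem tendsto_gamma_ratio_mul_gamma_ratio {a b : ℝ → ℝ} {s : Set ℝ} {l₀ : ℝ} (k : ℕ)
    (ha : Continuous a) (hb : Continuous b)
    (hs : ∀ l ∈ s, ¬ IsNonposInt (a l) ∧ ¬ IsNonposInt (b l))
    (hb₀ : (ascPochhammer ℝ k).eval (b l₀) ≠ 0) :
    Tendsto
      (fun l => Real.Gamma (a l + k) / Real.Gamma (a l) *
        (Real.Gamma (b l) / Real.Gamma (b l + k)))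
      (nhdsWithin l₀ s)
      (nhds ((ascPochhammer ℝ k).eval (a l₀) / (ascPochhammer ℝ k).eval (b l₀))) := by
  have hlim : Tendsto
      (fun l => (ascPochhammer ℝ k).eval (a l) / (ascPochhammer ℝ k).eval (b l)) (nhds l₀)
      (nhds ((ascPochhammer ℝ k).eval (a l₀) / (ascPochhammer ℝ k).eval (b l₀))) :=
    Tendsto.div ((ascPochhammer ℝ k).continuous.comp ha).continuousAt
      ((ascPochhammer ℝ k).continuous.comp hb).continuousAt hb₀
  refine (hlim.mono_left nhdsWithin_le_nhds).congr' ?_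
  filter_upwards [self_mem_nhdsWithin] with l hl
  obtain ⟨hal, hbl⟩ := hs l hl
  have hΓa := Real.Gamma_ne_zero_of_not_isNonposInt hal
  have hΓb := Real.Gamma_ne_zero_of_not_isNonposInt hbl
  rw [Real.Gamma_add_natCast_eq_ascPochhammer_eval_mul hal,
    Real.Gamma_add_natCast_eq_ascPochhammer_eval_mul hbl, mul_div_cancel_right₀ _ hΓa,
    div_mul_cancel_right₀ hΓb, div_eq_mul_inv]

theorem LambdaPlus.nonneg_or {d p q : ℕ} {m : Fin p → ℤ} (hm : LambdaPlus d p q m) (j : Fin p) :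
    0 ≤ m j ∨ (d = 1 ∧ p = q ∧ (j : ℕ) + 1 = p) := by
  by_cases hdp : d = 1 ∧ p = q
  · by_cases hj : (j : ℕ) + 1 = p
    · exact Or.inr ⟨hdp.1, hdp.2, hj⟩
    · have hlt : (j : ℕ) + 1 < p := by omega
      exact Or.inl ((abs_nonneg _).trans
        (hm.2.1 j ⟨(j : ℕ) + 1, hlt⟩ (Fin.lt_def.2 (Nat.lt_succ_self _))))
  · exact Or.inl (hm.2.2 hdp j)

/-- Each factor of `Rfun` has a limit at the first pole. The limit of the first factor is nonzero,
and that of the second factor vanishes as soon as its weight is nonzero. -/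
theorem exists_tendsto_Rfun_factor {d p q : ℕ} (hd : 0 < d) (hp : 2 ≤ p) (hpq : p ≤ q)
    {m : Fin p → ℤ} (hm : LambdaPlus d p q m) (j : Fin p) :
    ∃ c : ℝ,
      Tendsto (fun l : ℝ =>
        (Real.Gamma (-(d : ℝ) * l / 2 - (d : ℝ) * ((j : ℕ) : ℝ) / 2 + (m j : ℝ) / 2) /
            Real.Gamma (-(d : ℝ) * l / 2 - (d : ℝ) * ((j : ℕ) : ℝ) / 2)) *
          (Real.Gamma ((d : ℝ) * (l + (p : ℝ) + (q : ℝ)) / 2 - (d : ℝ) * ((j : ℕ) : ℝ) / 2) /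
            Real.Gamma
              ((d : ℝ) * (l + (p : ℝ) + (q : ℝ)) / 2 - (d : ℝ) * ((j : ℕ) : ℝ) / 2 +
                (m j : ℝ) / 2)))
        (nhdsWithin (-1) (RDom d p q m \ {-1})) (nhds c) ∧
      ((j : ℕ) = 0 → c ≠ 0) ∧ (m j = 0 → c ≠ 0) ∧ ((j : ℕ) = 1 → m j ≠ 0 → c = 0) := by
  have hdR : (0 : ℝ) < d := Nat.cast_pos.2 hd
  have hpR : (2 : ℝ) ≤ p := by exact_mod_cast hp
  have hpqR : (p : ℝ) ≤ q := by exact_mod_cast hpq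
  have hjR : ((j : ℕ) : ℝ) + 1 ≤ p := by exact_mod_cast j.isLt
  obtain ⟨k, hk⟩ := hm.1 j
  have hcast : (m j : ℝ) / 2 = (k : ℝ) := by rw [hk]; push_cast; ring
  rw [hcast]
  rcases le_or_gt 0 k with hk0 | hk0
  · lift k to ℕ using hk0
    simp only [Int.cast_natCast] at hcast ⊢
    have hb₀ : 0 < (d : ℝ) * (-1 + p + q) / 2 - (d : ℝ) * ((j : ℕ) : ℝ) / 2 := by
      have : 0 < (d : ℝ) * (-1 + p + q - (j : ℕ)) := mul_pos hdR (by linarith)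
      linarith
    refine ⟨_, tendsto_gamma_ratio_mul_gamma_ratio k (by fun_prop) (by fun_prop)
      (fun l hl => ⟨(hl.1 j).2.1, (hl.1 j).2.2.1⟩)
      (ascPochhammer_eval_ne_zero_of_pos hb₀ k), ?_, ?_, ?_⟩
    · intro hj
      refine div_ne_zero (ascPochhammer_eval_ne_zero_of_pos ?_ k)
        (ascPochhammer_eval_ne_zero_of_pos hb₀ k)
      simp [hj, hdR]
    · intro hmj
      obtain rfl : k = 0 := by omega
      simp
    · intro hj hmj
      have hk : k ≠ 0 := by omega
      simp [hj, hk]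
  · have hneg : m j < 0 := by omega
    obtain ⟨rfl, rfl, hjp⟩ := (hm.nonneg_or j).resolve_left (by omega)
    obtain ⟨κ, rfl⟩ : ∃ κ : ℕ, k = -(κ : ℤ) := ⟨k.natAbs, by omega⟩
    have hκ : 0 < κ := by omega
    simp only [Int.cast_neg, Int.cast_natCast] at hcast ⊢
    have hjp' : ((j : ℕ) : ℝ) + 1 = p := by exact_mod_cast hjp
    have key := tendsto_gamma_ratio_mul_gamma_ratio (s := RDom 1 p p m \ {-1}) (l₀ := -1) κ
      (a := fun l => ((1 : ℕ) : ℝ) * (l + p + p) / 2 - ((1 : ℕ) : ℝ) * ((j : ℕ) : ℝ) / 2 + -(κ : ℝ))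
      (b := fun l => -((1 : ℕ) : ℝ) * l / 2 - ((1 : ℕ) : ℝ) * ((j : ℕ) : ℝ) / 2 + -(κ : ℝ))
      (by fun_prop) (by fun_prop)
      (fun l hl => by
        have := hl.1 j
        rw [hcast] at this
        exact ⟨this.2.2.2, this.1⟩)
      (by
        rw [Ne, ascPochhammer_eval_eq_zero_iff]
        rintro ⟨i, hi, h⟩
        have hi' : (i : ℝ) + 1 ≤ κ := by exact_mod_cast hi
        push_cast at h
        linarith)
    refine ⟨_, key.congr fun l => ?_, ?_, ?_, ?_⟩
    · simp only [neg_add_cancel_right]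
      ring
    · omega
    · omega
    · intro hj _
      rw [div_eq_zero_iff, ascPochhammer_eval_eq_zero_iff]
      have hp2 : (p : ℝ) = 2 := by rw [← hjp', hj]; norm_num
      refine Or.inl ⟨κ - 1, by omega, ?_⟩
      rw [Nat.cast_sub hκ, hj, hp2]
      push_cast
      ring

/-- Section 3.5 of the paper: the eigenvalue ratio `R(λ)` has a finite
limit as `λ → -1`, which is nonzero iff `m₂ = ⋯ = m_p = 0`. -/
theorem eigenvalue_ratio_limit_at_first_pole
    (d p q : ℕ) (hd : d = 1 ∨ d = 2 ∨ d = 4) (hp : 2 ≤ p) (hpq : p ≤ q)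
    (m : Fin p → ℤ) (hm : LambdaPlus d p q m) :
    ∃ c : ℝ,
      Tendsto (Rfun d p q m) (nhdsWithin (-1) (RDom d p q m \ {-1})) (nhds c) ∧
      (c ≠ 0 ↔ ∀ j : Fin p, 1 ≤ (j : ℕ) → m j = 0) := by
  choose c hc hc0 hcm hc1 using exists_tendsto_Rfun_factor (by omega : 0 < d) hp hpq hm
  refine ⟨∏ j, c j, tendsto_finsetProd _ fun j _ => hc j, ?_⟩
  rw [Finset.prod_ne_zero_iff]
  constructor
  · intro h j hj
    have hm1 : m ⟨1, hp⟩ = 0 := by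
      by_contra hne
      exact h _ (Finset.mem_univ _) (hc1 ⟨1, hp⟩ rfl hne)
    rcases hj.eq_or_lt with hj | hj
    · rwa [show j = ⟨1, hp⟩ from Fin.ext hj.symm]
    · have := hm.2.1 ⟨1, hp⟩ j (Fin.lt_def.2 hj)
      rw [hm1] at this
      exact abs_nonpos_iff.1 this
  · intro h j _
    rcases Nat.eq_zero_or_pos (j : ℕ) with hj | hj
    · exact hc0 j hj
    · exact hcm j (h j hj)
end

section
/- Let d ∈ {1,2} and let p, q be integers with q ≥ p ≥ 1 and not (d = 1 and p = 1). Then: (a) for every positive integer m there exists μ ∈ Λ⁺(B) such that |η_μ(λ)| → ∞ as λ → −m (along the punctured neighborhood of −m intersected with the domain of η_μ); and (b) for every real λ₀ that is not a negative integer and every μ ∈ Λ⁺(B), the function η_μ has a finite limit at λ₀. (That is, for d = 1 or 2 the poles of the cosine-λ transform occur exactly at the negative integers −1, −2, −3, ….) -/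
open Filter Set

/-- The eigenvalue `η_μ(λ)` of the cosine-λ transform on `Gr(p, 𝕂^{p+q})`
(`d = dim_ℝ 𝕂`) on the K-type of highest weight `μ = m`. -/
noncomputable def eta (d p q : ℕ) (m : Fin p → ℤ) (l : ℝ) : ℝ :=
  (-1 : ℝ) ^ ((∑ j, m j) / 2) *
    ((∏ j : Fin p,
        Real.Gamma ((d : ℝ) * ((p : ℝ) + (q : ℝ)) / 2 - (d : ℝ) * ((j : ℕ) : ℝ) / 2)) /
      (∏ j : Fin p, Real.Gamma ((d : ℝ) * (p : ℝ) / 2 - (d : ℝ) * ((j : ℕ) : ℝ) / 2))) *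
    (∏ j : Fin p,
      Real.Gamma ((d : ℝ) * (l + (p : ℝ)) / 2 - (d : ℝ) * ((j : ℕ) : ℝ) / 2) *
        Real.Gamma ((-(d : ℝ) * l + (m j : ℝ)) / 2 - (d : ℝ) * ((j : ℕ) : ℝ) / 2)) /
    (∏ j : Fin p,
      Real.Gamma (-(d : ℝ) * l / 2 - (d : ℝ) * ((j : ℕ) : ℝ) / 2) *
        Real.Gamma
          (((d : ℝ) * l + (d : ℝ) * ((p : ℝ) + (q : ℝ)) + (m j : ℝ)) / 2 -
            (d : ℝ) * ((j : ℕ) : ℝ) / 2))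

/-- Domain of `η_μ`: the set of real `λ` at which no Gamma argument appearing in the
formula for `η_μ(λ)` is a nonpositive integer. -/
def etaDom (d p q : ℕ) (m : Fin p → ℤ) : Set ℝ :=
  {l | ∀ j : Fin p,
    ¬ IsNonposInt ((d : ℝ) * (l + (p : ℝ)) / 2 - (d : ℝ) * ((j : ℕ) : ℝ) / 2) ∧
    ¬ IsNonposInt ((-(d : ℝ) * l + (m j : ℝ)) / 2 - (d : ℝ) * ((j : ℕ) : ℝ) / 2) ∧
    ¬ IsNonposInt (-(d : ℝ) * l / 2 - (d : ℝ) * ((j : ℕ) : ℝ) / 2) ∧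
    ¬ IsNonposInt
        (((d : ℝ) * l + (d : ℝ) * ((p : ℝ) + (q : ℝ)) + (m j : ℝ)) / 2 -
          (d : ℝ) * ((j : ℕ) : ℝ) / 2)}

theorem Real.continuous_inv_Gamma : Continuous fun x : ℝ => (Real.Gamma x)⁻¹ := by
  have h : (fun x : ℝ => (Real.Gamma x)⁻¹) = fun x : ℝ => ((Complex.Gamma x)⁻¹).re := by
    funext x
    rw [Complex.Gamma_ofReal, ← Complex.ofReal_inv, Complex.ofReal_re]
  rw [h]
  exact Complex.continuous_re.comp
    (Complex.differentiable_one_div_Gamma.continuous.comp Complex.continuous_ofReal)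

theorem Real.continuousAt_Gamma_of_not_isNonposInt {x : ℝ} (hx : ¬ IsNonposInt x) :
    ContinuousAt Real.Gamma x :=
  (Real.differentiableAt_Gamma fun k hk => hx ⟨k, hk⟩).continuousAt

theorem Real.continuousAt_Gamma_of_pos {x : ℝ} (hx : 0 < x) : ContinuousAt Real.Gamma x :=
  Real.continuousAt_Gamma_of_not_isNonposInt fun ⟨k, hk⟩ => by
    have : (0 : ℝ) ≤ k := k.cast_nonneg
    linarith

theorem Real.eventually_sin_pi_mul_ne_zero (x₀ : ℝ) :
    ∀ᶠ x in nhdsWithin x₀ {x₀}ᶜ, Real.sin (Real.pi * x) ≠ 0 := by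
  have hderiv : HasDerivAt (fun x : ℝ => Real.sin (Real.pi * x))
      (Real.cos (Real.pi * x₀) * Real.pi) x₀ := by
    simpa using ((hasDerivAt_id x₀).const_mul Real.pi).sin
  by_cases h : Real.sin (Real.pi * x₀) = 0
  · refine hderiv.eventually_ne (mul_ne_zero (fun hc => ?_) Real.pi_ne_zero)
    have := Real.sin_sq_add_cos_sq (Real.pi * x₀)
    rw [h, hc] at this
    norm_num at this
  · exact nhdsWithin_le_nhds (hderiv.continuousAt.eventually_ne h)

/-- The reflection formula applied to a quotient of Gamma values at points differing by an
integer. -/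
theorem Real.Gamma_add_int_div_Gamma (x : ℝ) (M : ℤ) (hx : Real.sin (Real.pi * x) ≠ 0) :
    Real.Gamma (x + M) / Real.Gamma x =
      (-1) ^ M * (Real.Gamma (1 - x) * (Real.Gamma (1 - (x + M)))⁻¹) := by
  have h₁ := Real.Gamma_mul_Gamma_one_sub x
  have h₂ := Real.Gamma_mul_Gamma_one_sub (x + M)
  have hs : Real.sin (Real.pi * (x + M)) = (-1) ^ M * Real.sin (Real.pi * x) := by
    rw [← Real.sin_add_int_mul_pi]
    congr 1
    ring
  have hsign : ((-1 : ℝ) ^ M) * (-1) ^ M = 1 := by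
    rw [← mul_zpow]
    norm_num
  have hsign₀ : ((-1 : ℝ) ^ M) ≠ 0 := left_ne_zero_of_mul_eq_one hsign
  have hne₁ : Real.Gamma x * Real.Gamma (1 - x) ≠ 0 := by
    rw [h₁]
    exact div_ne_zero Real.pi_ne_zero hx
  have hne₂ : Real.Gamma (x + M) * Real.Gamma (1 - (x + M)) ≠ 0 := by
    rw [h₂, hs]
    exact div_ne_zero Real.pi_ne_zero (mul_ne_zero hsign₀ hx)
  have key : Real.Gamma (x + M) * Real.Gamma (1 - (x + M)) =
      (-1) ^ M * (Real.Gamma x * Real.Gamma (1 - x)) := by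
    rw [h₁, h₂, hs]
    field_simp
    rw [pow_two, hsign]
  rw [div_eq_iff (left_ne_zero_of_mul hne₁)]
  have h₃ := right_ne_zero_of_mul hne₂
  field_simp
  linear_combination key

theorem Real.exists_tendsto_Gamma_add_int_div_Gamma (x₀ : ℝ) (M : ℤ)
    (hx₀ : ¬ IsNonposInt (1 - x₀)) :
    ∃ c : ℝ, Tendsto (fun x => Real.Gamma (x + M) / Real.Gamma x)
      (nhdsWithin x₀ {x₀}ᶜ) (nhds c) := by
  have hcont : ContinuousAt
      (fun x : ℝ => (-1 : ℝ) ^ M * (Real.Gamma (1 - x) * (Real.Gamma (1 - (x + M)))⁻¹)) x₀ := by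
    refine continuousAt_const.mul (ContinuousAt.mul ?_ ?_)
    · exact ContinuousAt.comp (f := fun x : ℝ => 1 - x)
        (Real.continuousAt_Gamma_of_not_isNonposInt hx₀) (by fun_prop)
    · exact (Real.continuous_inv_Gamma.comp
        (by fun_prop : Continuous fun x : ℝ => 1 - (x + M))).continuousAt
  refine ⟨_, (hcont.tendsto.mono_left nhdsWithin_le_nhds).congr' ?_⟩
  filter_upwards [Real.eventually_sin_pi_mul_ne_zero x₀] with x hx
  exact (Real.Gamma_add_int_div_Gamma x M hx).symm

/-- The part of `η_μ(λ)` that does not depend on `λ`. -/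
noncomputable def etaConst (d p q : ℕ) (m : Fin p → ℤ) : ℝ :=
  (-1 : ℝ) ^ ((∑ j, m j) / 2) *
    ((∏ j : Fin p,
        Real.Gamma ((d : ℝ) * ((p : ℝ) + (q : ℝ)) / 2 - (d : ℝ) * ((j : ℕ) : ℝ) / 2)) /
      (∏ j : Fin p, Real.Gamma ((d : ℝ) * (p : ℝ) / 2 - (d : ℝ) * ((j : ℕ) : ℝ) / 2)))

/-- The `j`-th Gamma factor of `η_μ(λ)` that does not depend on `μ`. -/
noncomputable def etaGamma (d p : ℕ) (j : Fin p) (l : ℝ) : ℝ :=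
  Real.Gamma ((d : ℝ) * (l + (p : ℝ)) / 2 - (d : ℝ) * ((j : ℕ) : ℝ) / 2)

/-- The quotient `Γ((-dλ + m_j)/2 - dj/2) / Γ(-dλ/2 - dj/2)` in `η_μ(λ)`. -/
noncomputable def etaRatio (d p : ℕ) (m : Fin p → ℤ) (j : Fin p) (l : ℝ) : ℝ :=
  Real.Gamma ((-(d : ℝ) * l + (m j : ℝ)) / 2 - (d : ℝ) * ((j : ℕ) : ℝ) / 2) /
    Real.Gamma (-(d : ℝ) * l / 2 - (d : ℝ) * ((j : ℕ) : ℝ) / 2)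

/-- The `j`-th inverse Gamma factor of `η_μ(λ)`. -/
noncomputable def etaInvGamma (d p q : ℕ) (m : Fin p → ℤ) (j : Fin p) (l : ℝ) : ℝ :=
  (Real.Gamma
    (((d : ℝ) * l + (d : ℝ) * ((p : ℝ) + (q : ℝ)) + (m j : ℝ)) / 2 -
      (d : ℝ) * ((j : ℕ) : ℝ) / 2))⁻¹

theorem eta_eq (d p q : ℕ) (m : Fin p → ℤ) (l : ℝ) :
    eta d p q m l = etaConst d p q m *
      ((∏ j, etaRatio d p m j l * etaInvGamma d p q m j l) * ∏ j, etaGamma d p j l) := by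
  unfold eta etaConst etaRatio etaInvGamma etaGamma
  simp only [Finset.prod_mul_distrib, Finset.prod_inv_distrib,
    div_eq_mul_inv, mul_inv]
  ring

theorem continuous_etaInvGamma (d p q : ℕ) (m : Fin p → ℤ) (j : Fin p) :
    Continuous (etaInvGamma d p q m j) := by
  unfold etaInvGamma
  exact Real.continuous_inv_Gamma.comp (by fun_prop)

theorem continuous_inv_etaGamma (d p : ℕ) (j : Fin p) :
    Continuous fun l => (etaGamma d p j l)⁻¹ := by
  unfold etaGamma
  exact Real.continuous_inv_Gamma.comp (by fun_prop)

theorem etaConst_ne_zero {d p : ℕ} (q : ℕ) (hd : 0 < d) (m : Fin p → ℤ) :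
    etaConst d p q m ≠ 0 := by
  have hd' : (0 : ℝ) < d := by exact_mod_cast hd
  have hj : ∀ j : Fin p, ((j : ℕ) : ℝ) < p := fun j => by exact_mod_cast j.isLt
  have hq : (0 : ℝ) ≤ q := q.cast_nonneg
  refine mul_ne_zero (zpow_ne_zero _ (by norm_num)) (div_ne_zero ?_ ?_) <;>
    refine Finset.prod_ne_zero_iff.2 fun j _ => (Real.Gamma_pos_of_pos ?_).ne'
  · have := mul_pos hd' (by linarith [hj j] : (0 : ℝ) < p + q - (j : ℕ))
    linarith
  · have := mul_pos hd' (by linarith [hj j] : (0 : ℝ) < p - (j : ℕ))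
    linarith

theorem exists_tendsto_etaRatio {d p : ℕ} (hd : d = 1 ∨ d = 2) (m : Fin p → ℤ) (j : Fin p)
    (hm : 2 ∣ m j) {l₀ : ℝ} (hl₀ : ¬ ∃ k : ℕ, 1 ≤ k ∧ l₀ = -(k : ℝ)) :
    ∃ c : ℝ, Tendsto (etaRatio d p m j) (nhdsWithin l₀ {l₀}ᶜ) (nhds c) := by
  obtain ⟨M, hM⟩ := hm
  have hx₀ : ¬ IsNonposInt (1 - (-(d : ℝ) * l₀ / 2 - (d : ℝ) * ((j : ℕ) : ℝ) / 2)) := by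
    rintro ⟨k, hk⟩
    rcases hd with rfl | rfl
    · refine hl₀ ⟨2 * (k + 1) + j, by omega, ?_⟩
      push_cast at hk ⊢
      linarith
    · refine hl₀ ⟨k + 1 + j, by omega, ?_⟩
      push_cast at hk ⊢
      linarith
  obtain ⟨c, hc⟩ := Real.exists_tendsto_Gamma_add_int_div_Gamma _ M hx₀
  have hd' : (d : ℝ) ≠ 0 := by rcases hd with rfl | rfl <;> norm_num
  have hlim : Tendsto (fun l : ℝ => -(d : ℝ) * l / 2 - (d : ℝ) * ((j : ℕ) : ℝ) / 2)
      (nhdsWithin l₀ {l₀}ᶜ)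
      (nhdsWithin (-(d : ℝ) * l₀ / 2 - (d : ℝ) * ((j : ℕ) : ℝ) / 2)
        {-(d : ℝ) * l₀ / 2 - (d : ℝ) * ((j : ℕ) : ℝ) / 2}ᶜ) := by
    refine tendsto_nhdsWithin_iff.2 ⟨?_, ?_⟩
    · exact (Continuous.tendsto (by fun_prop) l₀).mono_left nhdsWithin_le_nhds
    · filter_upwards [self_mem_nhdsWithin] with l hl h
      refine hl (mul_left_cancel₀ hd' ?_)
      simp only [mem_singleton_iff] at h
      linarith
  refine ⟨c, (hc.comp hlim).congr fun l => ?_⟩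
  simp only [Function.comp_apply, etaRatio, hM]
  congr 2
  push_cast
  ring

theorem continuousAt_etaGamma {d p : ℕ} (hd : d = 1 ∨ d = 2) (j : Fin p)
    {l₀ : ℝ} (hl₀ : ¬ ∃ k : ℕ, 1 ≤ k ∧ l₀ = -(k : ℝ)) :
    ContinuousAt (etaGamma d p j) l₀ := by
  refine ContinuousAt.comp
    (f := fun l : ℝ => (d : ℝ) * (l + (p : ℝ)) / 2 - (d : ℝ) * ((j : ℕ) : ℝ) / 2)
    (Real.continuousAt_Gamma_of_not_isNonposInt ?_) (by fun_prop)
  rintro ⟨k, hk⟩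
  obtain ⟨r, hr⟩ := Nat.exists_eq_add_of_lt j.isLt
  have hr' : (p : ℝ) = (j : ℕ) + r + 1 := by exact_mod_cast hr
  rw [hr'] at hk
  rcases hd with rfl | rfl
  · refine hl₀ ⟨2 * k + r + 1, by omega, ?_⟩
    push_cast at hk ⊢
    linarith
  · refine hl₀ ⟨k + r + 1, by omega, ?_⟩
    push_cast at hk ⊢
    linarith

theorem exists_tendsto_eta {d p : ℕ} (q : ℕ) (hd : d = 1 ∨ d = 2) (m : Fin p → ℤ)
    (hm : ∀ j, 2 ∣ m j) {l₀ : ℝ} (hl₀ : ¬ ∃ k : ℕ, 1 ≤ k ∧ l₀ = -(k : ℝ)) :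
    ∃ c : ℝ, Tendsto (eta d p q m) (nhdsWithin l₀ {l₀}ᶜ) (nhds c) := by
  choose c hc using fun j => exists_tendsto_etaRatio hd m j (hm j) hl₀
  exact ⟨_, Tendsto.congr (fun l => (eta_eq d p q m l).symm) (tendsto_const_nhds.mul
    ((tendsto_finsetProd _ fun j _ => (hc j).mul
      (((continuous_etaInvGamma d p q m j).tendsto l₀).mono_left nhdsWithin_le_nhds)).mul
      (tendsto_finsetProd _ fun j _ =>
        (continuousAt_etaGamma hd j hl₀).tendsto.mono_left nhdsWithin_le_nhds)))⟩

/-- The tuple `(2m₀, …, 2m₀, 0, …, 0)` with at most `m₀` nonzero entries, whose eigenvalue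
function has a pole at `-m₀`. -/
def poleWeight (p m₀ : ℕ) (j : Fin p) : ℤ := if (j : ℕ) < m₀ then 2 * m₀ else 0

theorem lambdaPlus_poleWeight (d p q m₀ : ℕ) : LambdaPlus d p q (poleWeight p m₀) := by
  refine ⟨fun i => ?_, fun i j hij => ?_, fun _ i => ?_⟩ <;> simp only [poleWeight]
  · split_ifs <;> simp
  · have : (i : ℕ) < j := hij
    split_ifs <;> first | omega | simp
  · split_ifs <;> simp

theorem exists_tendsto_etaRatio_poleWeight {d p : ℕ} (q : ℕ) (hd : 0 < d) (m₀ : ℕ)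
    (j : Fin p) : ∃ c : ℝ, c ≠ 0 ∧ Tendsto (etaRatio d p (poleWeight p m₀) j)
      (nhdsWithin (-(m₀ : ℝ)) (etaDom d p q (poleWeight p m₀) \ {-(m₀ : ℝ)})) (nhds c) := by
  have hd' : (0 : ℝ) < d := by exact_mod_cast hd
  by_cases hj : (j : ℕ) < m₀
  · have hj' : ((j : ℕ) : ℝ) < m₀ := by exact_mod_cast hj
    have hmul := mul_pos hd' (sub_pos.2 hj')
    have hm : ((poleWeight p m₀ j : ℤ) : ℝ) = 2 * m₀ := by simp [poleWeight, hj]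
    have hpos₁ : 0 < (-(d : ℝ) * -(m₀ : ℝ) + ((poleWeight p m₀ j : ℤ) : ℝ)) / 2 -
        (d : ℝ) * ((j : ℕ) : ℝ) / 2 := by
      rw [hm]
      have : (0 : ℝ) ≤ m₀ := m₀.cast_nonneg
      linarith
    have hpos₂ : 0 < -(d : ℝ) * -(m₀ : ℝ) / 2 - (d : ℝ) * ((j : ℕ) : ℝ) / 2 := by linarith
    have hcont : ContinuousAt (etaRatio d p (poleWeight p m₀) j) (-(m₀ : ℝ)) := by
      unfold etaRatio
      refine ContinuousAt.div ?_ ?_ (Real.Gamma_pos_of_pos hpos₂).ne'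
      · exact ContinuousAt.comp (f := fun l : ℝ => (-(d : ℝ) * l +
          ((poleWeight p m₀ j : ℤ) : ℝ)) / 2 - (d : ℝ) * ((j : ℕ) : ℝ) / 2)
          (Real.continuousAt_Gamma_of_pos hpos₁) (by fun_prop)
      · exact ContinuousAt.comp
          (f := fun l : ℝ => -(d : ℝ) * l / 2 - (d : ℝ) * ((j : ℕ) : ℝ) / 2)
          (Real.continuousAt_Gamma_of_pos hpos₂) (by fun_prop)
    exact ⟨_, (div_pos (Real.Gamma_pos_of_pos hpos₁) (Real.Gamma_pos_of_pos hpos₂)).ne',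
      hcont.tendsto.mono_left nhdsWithin_le_nhds⟩
  · refine ⟨1, one_ne_zero, tendsto_const_nhds.congr' ?_⟩
    filter_upwards [self_mem_nhdsWithin] with l hl
    have h := (hl.1 j).2.2.1
    have hm : ((poleWeight p m₀ j : ℤ) : ℝ) = 0 := by simp [poleWeight, hj]
    rw [etaRatio, hm, add_zero, div_self]
    exact Real.Gamma_ne_zero fun k hk => h ⟨k, hk⟩

theorem etaInvGamma_poleWeight_ne_zero {d p q : ℕ} (hd : 0 < d) (hpq : p ≤ q) (m₀ : ℕ)
    (j : Fin p) (hdm : d ≤ 2) : etaInvGamma d p q (poleWeight p m₀) j (-(m₀ : ℝ)) ≠ 0 := by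
  have hd' : (0 : ℝ) < d := by exact_mod_cast hd
  have hdm' : (d : ℝ) ≤ 2 := by exact_mod_cast hdm
  have hpq' : (p : ℝ) ≤ q := by exact_mod_cast hpq
  have hjp : ((j : ℕ) : ℝ) < p := by exact_mod_cast j.isLt
  have hm₀ : (0 : ℝ) ≤ m₀ := m₀.cast_nonneg
  have hp : (0 : ℝ) ≤ p := p.cast_nonneg
  refine inv_ne_zero (Real.Gamma_pos_of_pos ?_).ne'
  by_cases hj : (j : ℕ) < m₀
  · have hm : ((poleWeight p m₀ j : ℤ) : ℝ) = 2 * m₀ := by simp [poleWeight, hj]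
    rw [hm]
    have h₁ := mul_pos hd' (by linarith : (0 : ℝ) < p + q - (j : ℕ))
    have h₂ := mul_nonneg (sub_nonneg.2 hdm') hm₀
    linarith
  · have hj' : (m₀ : ℝ) ≤ (j : ℕ) := by exact_mod_cast not_lt.1 hj
    have hm : ((poleWeight p m₀ j : ℤ) : ℝ) = 0 := by simp [poleWeight, hj]
    rw [hm]
    have h₁ := mul_pos hd' (by linarith : (0 : ℝ) < p + q - (j : ℕ) - m₀)
    linarith

theorem exists_etaGamma_eq_zero {d p : ℕ} (hd : d = 1 ∨ d = 2) (hp : 1 ≤ p)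
    (hexc : ¬(d = 1 ∧ p = 1)) {m₀ : ℕ} (hm₀ : 1 ≤ m₀) :
    ∃ j : Fin p, etaGamma d p j (-(m₀ : ℝ)) = 0 := by
  suffices h : ∃ j : Fin p, ∃ k : ℕ,
      (d : ℝ) * (-(m₀ : ℝ) + (p : ℝ)) / 2 - (d : ℝ) * ((j : ℕ) : ℝ) / 2 = -(k : ℝ) by
    obtain ⟨j, k, hk⟩ := h
    exact ⟨j, by rw [etaGamma, hk, Real.Gamma_neg_nat_eq_zero]⟩
  suffices h : ∃ j : Fin p, ∃ k : ℕ, d * p + 2 * k = d * m₀ + d * (j : ℕ) by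
    obtain ⟨j, k, hk⟩ := h
    refine ⟨j, k, ?_⟩
    have hk' : (d : ℝ) * p + 2 * k = d * m₀ + d * ((j : ℕ) : ℝ) := by exact_mod_cast hk
    linarith
  rcases hd with rfl | rfl
  · rcases Nat.even_or_odd' m₀ with ⟨k, rfl | rfl⟩
    · exact ⟨⟨p - 2, by omega⟩, k - 1, by dsimp only; omega⟩
    · exact ⟨⟨p - 1, by omega⟩, k, by dsimp only; omega⟩
  · exact ⟨⟨p - 1, by omega⟩, m₀ - 1, by dsimp only; omega⟩

theorem tendsto_abs_eta_poleWeight {d p q : ℕ} (hd : d = 1 ∨ d = 2) (hp : 1 ≤ p)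
    (hpq : p ≤ q) (hexc : ¬(d = 1 ∧ p = 1)) {m₀ : ℕ} (hm₀ : 1 ≤ m₀) :
    Tendsto (fun l : ℝ => |eta d p q (poleWeight p m₀) l|)
      (nhdsWithin (-(m₀ : ℝ)) (etaDom d p q (poleWeight p m₀) \ {-(m₀ : ℝ)})) atTop := by
  have hd₀ : 0 < d := by omega
  choose c hc₀ hc using fun j : Fin p => exists_tendsto_etaRatio_poleWeight q hd₀ m₀ j
  have hreg := (tendsto_const_nhds (x := etaConst d p q (poleWeight p m₀))).mul
    (tendsto_finsetProd Finset.univ fun j _ => (hc j).mul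
      (((continuous_etaInvGamma d p q (poleWeight p m₀) j).tendsto (-(m₀ : ℝ))).mono_left
        nhdsWithin_le_nhds))
  have hlim_ne := mul_ne_zero (etaConst_ne_zero q hd₀ (poleWeight p m₀))
    (Finset.prod_ne_zero_iff.2 fun j (_ : j ∈ Finset.univ) => mul_ne_zero (hc₀ j)
      (etaInvGamma_poleWeight_ne_zero hd₀ hpq m₀ j (by omega)))
  have hinv : Tendsto (fun l => ∏ j, (etaGamma d p j l)⁻¹)
      (nhdsWithin (-(m₀ : ℝ)) (etaDom d p q (poleWeight p m₀) \ {-(m₀ : ℝ)}))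
      (nhdsWithin 0 {0}ᶜ) := by
    refine tendsto_nhdsWithin_iff.2 ⟨?_, ?_⟩
    · have hzero : ∏ j, (etaGamma d p j (-(m₀ : ℝ)))⁻¹ = 0 := by
        obtain ⟨j, hj⟩ := exists_etaGamma_eq_zero hd hp hexc hm₀
        exact Finset.prod_eq_zero (Finset.mem_univ j) (by rw [hj, inv_zero])
      rw [← hzero]
      exact tendsto_finsetProd _ fun j _ =>
        ((continuous_inv_etaGamma d p j).tendsto _).mono_left nhdsWithin_le_nhds
    · filter_upwards [self_mem_nhdsWithin] with l hl
      exact Finset.prod_ne_zero_iff.2 fun j _ => inv_ne_zero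
        (Real.Gamma_ne_zero fun k hk => (hl.1 j).1 ⟨k, hk⟩)
  refine (hreg.abs.pos_mul_atTop (abs_pos.2 hlim_ne)
    (tendsto_norm_inv_nhdsNE_zero_atTop.comp hinv)).congr fun l => ?_
  simp only [Function.comp_apply, Real.norm_eq_abs]
  rw [← abs_mul, eta_eq, Finset.prod_inv_distrib, inv_inv, mul_assoc]

/-- for d = 1 or 2 (excluding the case d = 1, p = 1), the poles of the
cosine-λ transform occur exactly at the negative integers -1, -2, -3, …. -/
theorem poles_exactly_at_negative_integers
    (d p q : ℕ) (hd : d = 1 ∨ d = 2) (hp : 1 ≤ p) (hpq : p ≤ q)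
    (hexc : ¬(d = 1 ∧ p = 1)) :
    (∀ m₀ : ℕ, 1 ≤ m₀ →
      ∃ m : Fin p → ℤ, LambdaPlus d p q m ∧
        Tendsto (fun l : ℝ => |eta d p q m l|)
          (nhdsWithin (-(m₀ : ℝ)) (etaDom d p q m \ {-(m₀ : ℝ)})) atTop) ∧
    (∀ l₀ : ℝ, (¬ ∃ k : ℕ, 1 ≤ k ∧ l₀ = -(k : ℝ)) →
      ∀ m : Fin p → ℤ, LambdaPlus d p q m →
        ∃ c : ℝ, Tendsto (eta d p q m)
          (nhdsWithin l₀ (etaDom d p q m \ {l₀})) (nhds c)) := by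
  exact ⟨fun m₀ hm₀ => ⟨poleWeight p m₀, lambdaPlus_poleWeight d p q m₀,
      tendsto_abs_eta_poleWeight hd hp hpq hexc hm₀⟩,
    fun l₀ hl₀ m hm => (exists_tendsto_eta q hd m hm.1 hl₀).imp fun _ hc =>
      hc.mono_left (nhdsWithin_mono _ fun _ hl => hl.2)⟩
end
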